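/- For each pair (d, p) ∈ {(2, 17), (3, 11), (5, 11), (5, 19), (7, 19)}, the group X₀(p)(Q(√d)) coincides with the group X₀(p)(Q) of rational points; explicitly, X₀(17)(Q(√2)) has exactly 4 elements, X₀(11)(Q(√3)) and X₀(11)(Q(√5)) each have exactly 5 elements, and X₀(19)(Q(√5)) and X₀(19)(Q(√7)) each have exactly 3 elements. -/

import Mathlib

open Polynomial IntermediateField NumberField

/-- The modular curve `X₀(11)`: the elliptic curve `y² + y = x³ - x² - 10x - 20`
(Cremona label 11a1), with coefficients in the field `K`. -/
noncomputable def X0_11 (K : Type*) [Field K] : WeierstrassCurve.Affine K :=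
  { a₁ := 0, a₂ := -1, a₃ := 1, a₄ := -10, a₆ := -20 }

/-- The modular curve `X₀(17)`: the elliptic curve `y² + xy + y = x³ - x² - x - 14`
(Cremona label 17a1), with coefficients in the field `K`. -/
noncomputable def X0_17 (K : Type*) [Field K] : WeierstrassCurve.Affine K :=
  { a₁ := 1, a₂ := -1, a₃ := 1, a₄ := -1, a₆ := -14 }

/-- The modular curve `X₀(19)`: the elliptic curve `y² + y = x³ + x² - 9x - 15`
(Cremona label 19a3), with coefficients in the field `K`. -/
noncomputable def X0_19 (K : Type*) [Field K] : WeierstrassCurve.Affine K :=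
  { a₁ := 0, a₂ := 1, a₃ := 1, a₄ := -9, a₆ := -15 }

/-- Every `K`-point of the Weierstrass curve `W` has both coordinates in the image of `ℚ`,
i.e. `W(K)` coincides with the group of rational points `W(ℚ)`. -/
def PointsRational {K : Type*} [Field K] [CharZero K] (W : WeierstrassCurve.Affine K) : Prop :=
  ∀ x y : K, W.Nonsingular x y → (∃ a : ℚ, (a : K) = x) ∧ ∃ b : ℚ, (b : K) = y


section
open Polynomial IntermediateField NumberField
open scoped Matrix

/-- A cubic field presented by a power basis `1, θ, θ²` with `θ³ + aθ² + bθ + c = 0`. -/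
structure CubicData (F : Type) [Field F] [NumberField F] (a b c : ℤ) where
  θ : F
  B : Module.Basis (Fin 3) ℚ F
  h0 : B 0 = 1
  h1 : B 1 = θ
  h2 : B 2 = θ ^ 2
  hθ : θ ^ 3 = -(a : F) * θ ^ 2 - b * θ - c

namespace CubicData

variable {F : Type} [Field F] [NumberField F] {a b c : ℤ} (D : CubicData F a b c)

/-- The element `p + qθ + rθ²`. -/
def el (p q r : ℚ) : F := p + q * D.θ + r * D.θ ^ 2

theorem el_eq (p q r : ℚ) : D.el p q r = ∑ i, (![p, q, r] i) • D.B i := by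
  simp [Fin.sum_univ_three, D.h0, D.h1, D.h2, el, Algebra.smul_def]

theorem repr_el (p q r : ℚ) (i : Fin 3) : D.B.repr (D.el p q r) i = ![p, q, r] i := by
  rw [el_eq, Module.Basis.repr_sum_self]

theorem exists_el (x : F) : ∃ p q r : ℚ, x = D.el p q r := by
  refine ⟨D.B.repr x 0, D.B.repr x 1, D.B.repr x 2, ?_⟩
  conv_lhs => rw [← D.B.sum_repr x]
  simp [Fin.sum_univ_three, D.h0, D.h1, D.h2, el, Algebra.smul_def]

theorem el_inj {p q r p' q' r' : ℚ} (h : D.el p q r = D.el p' q' r') :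
    p = p' ∧ q = q' ∧ r = r' := by
  have := fun i => congrArg (fun y => D.B.repr y i) h
  simp only [repr_el] at this
  exact ⟨by simpa using this 0, by simpa using this 1, by simpa using this 2⟩

theorem el_mul (p q r s t u : ℚ) : D.el p q r * D.el s t u =
    D.el (p * s - c * (q * u + r * t) + a * c * (r * u))
      (p * t + q * s - b * (q * u + r * t) + (a * b - c) * (r * u))
      (p * u + q * t + r * s - a * (q * u + r * t) + (a ^ 2 - b) * (r * u)) := by
  simp only [el]
  push_cast
  linear_combination (q * u + r * t + r * u * (D.θ - a) : F) * D.hθ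

theorem leftMul (p q r : ℚ) : Algebra.leftMulMatrix D.B (D.el p q r) =
    !![p, -c * r, -c * q + a * c * r;
       q, p - b * r, -b * q + (a * b - c) * r;
       r, q - a * r, p - a * q + (a ^ 2 - b) * r] := by
  have e0 : D.B 0 = D.el 1 0 0 := by simp [D.h0, el]
  have e1 : D.B 1 = D.el 0 1 0 := by simp [D.h1, el]
  have e2 : D.B 2 = D.el 0 0 1 := by simp [D.h2, el]
  ext i j
  rw [Algebra.leftMulMatrix_eq_repr_mul]
  fin_cases j <;> simp only [Fin.zero_eta, Fin.mk_one, Fin.reduceFinMk, e0, e1, e2, el_mul, repr_el] <;>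
    fin_cases i <;> simp

theorem norm_el (p q r : ℚ) : Algebra.norm ℚ (D.el p q r) =
    p * ((p - b * r) * (p - a * q + (a ^ 2 - b) * r) - (-b * q + (a * b - c) * r) * (q - a * r))
    - q * ((-c * r) * (p - a * q + (a ^ 2 - b) * r) - (-c * q + a * c * r) * (q - a * r))
    + r * ((-c * r) * (-b * q + (a * b - c) * r) - (-c * q + a * c * r) * (p - b * r)) := by
  rw [Algebra.norm_eq_matrix_det D.B, leftMul, Matrix.det_fin_three]
  simp
  ring

theorem trace_el (p q r : ℚ) : Algebra.trace ℚ F (D.el p q r) =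
    3 * p - a * q + (a ^ 2 - 2 * b) * r := by
  rw [Algebra.trace_eq_matrix_trace D.B, leftMul, Matrix.trace_fin_three]
  simp
  ring

theorem discr_B : Algebra.discr ℚ D.B =
    a ^ 2 * b ^ 2 - 4 * b ^ 3 - 4 * a ^ 3 * c - 27 * c ^ 2 + 18 * a * b * c := by
  have e0 : D.B 0 = D.el 1 0 0 := by simp [D.h0, el]
  have e1 : D.B 1 = D.el 0 1 0 := by simp [D.h1, el]
  have e2 : D.B 2 = D.el 0 0 1 := by simp [D.h2, el]
  rw [Algebra.discr_def, Matrix.det_fin_three]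
  simp only [Algebra.traceMatrix_apply, Algebra.traceForm_apply, e0, e1, e2, el_mul, trace_el]
  ring

theorem finrank (D : CubicData F a b c) : Module.finrank ℚ F = 3 := by
  rw [Module.finrank_eq_card_basis D.B]; rfl

theorem isIntegral_θ : IsIntegral ℤ D.θ := by
  refine ⟨X ^ 3 + (C a * X ^ 2 + C b * X + C c), ?_, ?_⟩
  · monicity!
  · simp only [eval₂_add, eval₂_mul, eval₂_pow, eval₂_X, eval₂_C, D.hθ]
    simp only [algebraMap_int_eq, eq_intCast]
    ring

theorem isIntegral_el (p q r : ℤ) : IsIntegral ℤ (D.el p q r) := by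
  have h := D.isIntegral_θ
  simp only [el]
  push_cast
  have hi : ∀ n : ℤ, IsIntegral ℤ (n : F) := fun n => by
    simpa using isIntegral_algebraMap (R := ℤ) (A := F) (x := n)
  exact ((hi p).add ((hi q).mul h)).add ((hi r).mul (h.pow 2))

/-- `p + qθ + rθ²` as an algebraic integer. -/
noncomputable def ie (p q r : ℤ) : 𝓞 F := ⟨D.el p q r, D.isIntegral_el p q r⟩

@[simp] theorem coe_ie (p q r : ℤ) : ((D.ie p q r : 𝓞 F) : F) = D.el p q r := rfl

theorem discr_mul_sq (D : CubicData F a b c) : ∃ k : ℤ, k ≠ 0 ∧ discr F * k ^ 2 =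
    a ^ 2 * b ^ 2 - 4 * b ^ 3 - 4 * a ^ 3 * c - 27 * c ^ 2 + 18 * a * b * c := by
  classical
  have hcard : Fintype.card (Module.Free.ChooseBasisIndex ℤ (𝓞 F)) = 3 := by
    rw [← Module.finrank_eq_card_chooseBasisIndex, RingOfIntegers.rank, D.finrank]
  let e : Module.Free.ChooseBasisIndex ℤ (𝓞 F) ≃ Fin 3 := Fintype.equivFinOfCardEq hcard
  let I := (RingOfIntegers.basis F).reindex e
  have hI : discr F = Algebra.discr ℤ I := by
    rw [discr_eq_discr]
  let v : Fin 3 → 𝓞 F := ![D.ie 1 0 0, D.ie 0 1 0, D.ie 0 0 1]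
  have hv : ∀ i, ((v i : 𝓞 F) : F) = D.B i := by
    intro i
    fin_cases i <;> simp [v, el, D.h0, D.h1, D.h2]
  let P : Matrix (Fin 3) (Fin 3) ℤ := I.toMatrix v
  have hP : (I : Fin 3 → 𝓞 F) ᵥ* P.map (algebraMap ℤ (𝓞 F)) = v := by
    ext1 j
    simp only [Matrix.vecMul, dotProduct, P, Matrix.map_apply]
    rw [← I.sum_toMatrix_smul_self v j]
    refine Finset.sum_congr rfl fun i _ => ?_
    rw [Algebra.smul_def, mul_comm]
  have h3 : Algebra.discr ℤ v = P.det ^ 2 * discr F := by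
    rw [hI, ← Algebra.discr_of_matrix_vecMul, hP]
  have h4 : ((Algebra.discr ℤ v : ℤ) : ℚ) = Algebra.discr ℚ D.B := by
    rw [Algebra.discr_def, Algebra.discr_def, ← eq_intCast (Int.castRingHom ℚ), RingHom.map_det]
    congr 1
    ext i j
    simp only [RingHom.mapMatrix_apply, Matrix.map_apply, Algebra.traceMatrix_apply,
      Algebra.traceForm_apply, eq_intCast, Algebra.coe_trace_int, ← hv, map_mul]
  have h5 : Algebra.discr ℚ D.B ≠ 0 := Algebra.discr_not_zero_of_basis ℚ D.B
  refine ⟨P.det, ?_, ?_⟩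
  · intro h
    rw [h3, h] at h4
    simp at h4
    exact h5 h4.symm
  · rw [D.discr_B, h3] at h4
    have h6 : P.det ^ 2 * discr F =
      a ^ 2 * b ^ 2 - 4 * b ^ 3 - 4 * a ^ 3 * c - 27 * c ^ 2 + 18 * a * b * c := by exact_mod_cast h4
    rw [← h6]; ring

end CubicData

end

section
open Polynomial IntermediateField NumberField
open scoped Matrix

theorem ufd_class {R : Type*} [CommRing R] [IsDomain R] [UniqueFactorizationMonoid R]
    (p1 p2 : R) (a : R) : a ≠ 0 → ∀ b s : R,
    a * b = s ^ 2 →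
    (∀ p : R, Prime p → p ∣ a → p ∣ b → p ∣ p1 ∨ p ∣ p2) →
    Prime p1 → Prime p2 →
    ∃ (e : Rˣ) (i j : ℕ) (c : R), a = e * p1 ^ i * p2 ^ j * c ^ 2 := by
  induction a using (wellFounded_dvdNotUnit (α := R)).induction with
  | _ a ih => ?_
  intro ha b s hab hc hp1 hp2
  by_cases hu : IsUnit a
  · obtain ⟨e, he⟩ := hu
    exact ⟨e, 0, 0, 1, by simp [he]⟩
  obtain ⟨p, hp, hpa⟩ := WfDvdMonoid.exists_irreducible_factor hu ha
  have hp' : Prime p := UniqueFactorizationMonoid.irreducible_iff_prime.mp hp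
  have key : ∀ q : R, Prime q → ∀ a', a = q * a' → DvdNotUnit a' a := by
    intro q hq a' h
    refine ⟨fun h0 => ha (by rw [h, h0, mul_zero]), q, hq.not_isUnit, by rw [h, mul_comm]⟩
  by_cases h1 : p ∣ p1
  · have hd : p1 ∣ a := ((hp.associated_of_dvd hp1.irreducible h1).symm.dvd).trans hpa
    obtain ⟨a', rfl⟩ := hd
    obtain ⟨e, i, j, c, h⟩ := ih a' (key p1 hp1 a' rfl) (right_ne_zero_of_mul ha) (p1 * b) s
      (by rw [← hab]; ring) (fun q hq hqa hqb => by
        rcases hq.dvd_or_dvd hqb with h | h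
        · exact Or.inl h
        · exact hc q hq (dvd_mul_of_dvd_right hqa _) h) hp1 hp2
    exact ⟨e, i + 1, j, c, by rw [h]; ring⟩
  by_cases h2 : p ∣ p2
  · have hd : p2 ∣ a := ((hp.associated_of_dvd hp2.irreducible h2).symm.dvd).trans hpa
    obtain ⟨a', rfl⟩ := hd
    obtain ⟨e, i, j, c, h⟩ := ih a' (key p2 hp2 a' rfl) (right_ne_zero_of_mul ha) (p2 * b) s
      (by rw [← hab]; ring) (fun q hq hqa hqb => by
        rcases hq.dvd_or_dvd hqb with h | h
        · exact Or.inr h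
        · exact hc q hq (dvd_mul_of_dvd_right hqa _) h) hp1 hp2
    exact ⟨e, i, j + 1, c, by rw [h]; ring⟩
  have hpb : ¬ p ∣ b := fun h => by
    rcases hc p hp' hpa h with h | h
    · exact h1 h
    · exact h2 h
  have hps : p ∣ s := hp'.dvd_of_dvd_pow (hab ▸ dvd_mul_of_dvd_left hpa b)
  obtain ⟨s', rfl⟩ := hps
  have h3 : p ^ 2 ∣ a := by
    have : p ^ 2 ∣ a * b := by rw [hab, mul_pow]; exact dvd_mul_right _ _
    exact hp'.pow_dvd_of_dvd_mul_right 2 hpb this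
  obtain ⟨a', rfl⟩ := h3
  have hp0 := hp'.ne_zero
  obtain ⟨e, i, j, c, h⟩ := ih a' ⟨right_ne_zero_of_mul ha, p ^ 2,
      fun h => hp'.not_isUnit (isUnit_of_dvd_unit (dvd_pow_self p two_ne_zero) h), mul_comm _ _⟩
      (right_ne_zero_of_mul ha) b s'
      (by
        have : p ^ 2 * (a' * b) = p ^ 2 * s' ^ 2 := by rw [← mul_assoc, hab]; ring
        exact mul_left_cancel₀ (pow_ne_zero 2 hp0) this)
      (fun q hq hqa hqb => hc q hq (dvd_mul_of_dvd_right hqa _) hqb) hp1 hp2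
  exact ⟨e, i, j, p * c, by rw [h]; ring⟩

namespace CubicData

variable {F : Type} [Field F] [NumberField F] {a b c : ℤ} (D : CubicData F a b c)

theorem nrComplex (D : CubicData F a b c)
    (hd : a ^ 2 * b ^ 2 - 4 * b ^ 3 - 4 * a ^ 3 * c - 27 * c ^ 2 + 18 * a * b * c < 0) :
    InfinitePlace.nrComplexPlaces F = 1 := by
  obtain ⟨k, hk, h⟩ := D.discr_mul_sq
  have hk2 : 0 < k ^ 2 := by positivity
  have hneg : discr F < 0 := by
    by_contra! h'
    nlinarith [mul_nonneg h' hk2.le]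
  have h1 := InfinitePlace.card_add_two_mul_card_eq_rank F
  rw [D.finrank] at h1
  have h2 := sign_discr F
  rw [Int.sign_eq_neg_one_of_neg hneg] at h2
  have : InfinitePlace.nrComplexPlaces F ≠ 0 := by
    intro h0; rw [h0] at h2; norm_num at h2
  omega

theorem abs_discr_le (D : CubicData F a b c) (M : ℤ)
    (hd : |a ^ 2 * b ^ 2 - 4 * b ^ 3 - 4 * a ^ 3 * c - 27 * c ^ 2 + 18 * a * b * c| ≤ M) :
    |discr F| ≤ M := by
  obtain ⟨k, hk, h⟩ := D.discr_mul_sq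
  have hk2 : 1 ≤ k ^ 2 := by have : 0 < k ^ 2 := by positivity
                             omega
  rw [← h, abs_mul, abs_of_nonneg (by positivity : 0 ≤ k ^ 2)] at hd
  nlinarith [abs_nonneg (discr F)]

theorem rank_one (D : CubicData F a b c)
    (hd : a ^ 2 * b ^ 2 - 4 * b ^ 3 - 4 * a ^ 3 * c - 27 * c ^ 2 + 18 * a * b * c < 0) :
    Units.rank F = 1 := by
  have h1 := InfinitePlace.card_add_two_mul_card_eq_rank F
  rw [D.finrank, D.nrComplex hd] at h1
  rw [Units.rank, InfinitePlace.card_eq_nrRealPlaces_add_nrComplexPlaces, D.nrComplex hd]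
  omega

theorem coe_intNorm (x : 𝓞 F) : ((Algebra.norm ℤ x : ℤ) : ℚ) = Algebra.norm ℚ (x : F) :=
  Algebra.coe_norm_int x

theorem unit_class (D : CubicData F a b c)
    (hd : a ^ 2 * b ^ 2 - 4 * b ^ 3 - 4 * a ^ 3 * c - 27 * c ^ 2 + 18 * a * b * c < 0)
    (u : (𝓞 F)ˣ) (hu : Algebra.norm ℤ (u : 𝓞 F) = 1) (hns : ∀ v : (𝓞 F)ˣ, u ≠ v ^ 2)
    (e : (𝓞 F)ˣ) (he : Algebra.norm ℤ (e : 𝓞 F) = 1) :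
    ∃ v : (𝓞 F)ˣ, e = v ^ 2 ∨ e = u * v ^ 2 := by
  have hr := D.rank_one hd
  have hodd : Odd (Module.finrank ℚ F) := by rw [D.finrank]; decide
  let N : (𝓞 F)ˣ →* ℤˣ := Units.map (Algebra.norm ℤ : 𝓞 F →* ℤ)
  have hN : ∀ x : (𝓞 F)ˣ, ((N x : ℤˣ) : ℤ) = Algebra.norm ℤ (x : 𝓞 F) := fun x => rfl
  have hNm : N (-1) = -1 := by
    ext
    rw [hN]
    have : ((-1 : (𝓞 F)ˣ) : 𝓞 F) = algebraMap ℤ (𝓞 F) (-1) := by simp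
    rw [this, Algebra.norm_algebraMap, RingOfIntegers.rank, D.finrank]
    norm_num
  have hNu : N u = 1 := by ext; rw [hN, hu]; rfl
  have hNe : N e = 1 := by ext; rw [hN, he]; rfl
  -- normalized generator
  obtain ⟨f, hf1, hf⟩ : ∃ f : (𝓞 F)ˣ, N f = 1 ∧ ∀ x : (𝓞 F)ˣ, ∃ k : ℤ, x = f ^ k ∨ x = - f ^ k := by
    have hfs : ∀ f : (𝓞 F)ˣ, f = Units.fundSystem F ⟨0, by omega⟩ →
      ∀ x : (𝓞 F)ˣ, ∃ k : ℤ, x = f ^ k ∨ x = - f ^ k := by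
      intro f hff x
      obtain ⟨⟨z, k⟩, hx, -⟩ := Units.exist_unique_eq_mul_prod F x
      refine ⟨k ⟨0, by omega⟩, ?_⟩
      have hprod : ∏ i, (Units.fundSystem F i) ^ (k i) = f ^ (k ⟨0, by omega⟩) := by
        rw [hff]
        apply Finset.prod_eq_single_of_mem
        · simp
        · rintro ⟨i, hi⟩ - hne
          exact absurd (Fin.ext (by simp; omega)) hne
      rw [hx]
      simp only [hprod]
      rcases Units.torsion_eq_one_or_neg_one_of_odd_finrank hodd z with h | h
      · left; rw [h, one_mul]
      · right; rw [h]; simp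
    set f0 := Units.fundSystem F ⟨0, by omega⟩ with hf0
    rcases Int.units_eq_one_or (N f0) with h | h
    · exact ⟨f0, h, hfs f0 rfl⟩
    · refine ⟨-f0, ?_, ?_⟩
      · rw [← neg_one_mul, map_mul, hNm, h]; rfl
      · intro x
        obtain ⟨k, hk⟩ := hfs f0 rfl x
        refine ⟨k, ?_⟩
        have : (-f0) ^ k = f0 ^ k ∨ (-f0) ^ k = - f0 ^ k := by
          rcases Int.even_or_odd k with hh | hh
          · left; exact hh.neg_zpow f0
          · right; 
            obtain ⟨m, rfl⟩ := hh
            rw [zpow_add_one, zpow_add_one, (even_two_mul m).neg_zpow]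
            simp
        rcases this with h1 | h1 <;> rw [h1]
        · exact hk
        · rw [neg_neg]; exact hk.symm
  have hf' : ∀ x : (𝓞 F)ˣ, N x = 1 → ∃ k : ℤ, x = f ^ k := by
    intro x hx
    obtain ⟨k, hk | hk⟩ := hf x
    · exact ⟨k, hk⟩
    · exfalso
      rw [hk, ← neg_one_mul, map_mul, hNm, map_zpow, hf1, one_zpow, mul_one] at hx
      exact absurd hx (by decide)
  obtain ⟨k, hk⟩ := hf' u hNu
  obtain ⟨l, hl⟩ := hf' e hNe
  have hkodd : Odd k := by
    by_contra h
    rw [Int.not_odd_iff_even] at h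
    obtain ⟨m, hm⟩ := h
    exact hns (f ^ m) (by rw [hk, hm, sq, zpow_add])
  obtain ⟨k', hk'⟩ := hkodd
  rcases Int.even_or_odd' l with ⟨m, hm | hm⟩
  · exact ⟨f ^ m, Or.inl (by rw [hl, hm, two_mul, zpow_add, sq])⟩
  · refine ⟨f ^ (m - k'), Or.inr ?_⟩
    rw [hl, hk, hm, hk', ← zpow_natCast, ← zpow_mul, ← zpow_add]
    congr 1
    push_cast
    ring

theorem absNorm_ie (p q r : ℤ) (n : ℕ)
    (h : |p * ((p - b * r) * (p - a * q + (a ^ 2 - b) * r) - (-b * q + (a * b - c) * r) * (q - a * r))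
    - q * ((-c * r) * (p - a * q + (a ^ 2 - b) * r) - (-c * q + a * c * r) * (q - a * r))
    + r * ((-c * r) * (-b * q + (a * b - c) * r) - (-c * q + a * c * r) * (p - b * r))| = n) :
    Ideal.absNorm (Ideal.span {D.ie p q r}) = n := by
  rw [Ideal.absNorm_span_singleton]
  have : Algebra.norm ℤ (D.ie p q r) = p * ((p - b * r) * (p - a * q + (a ^ 2 - b) * r) - (-b * q + (a * b - c) * r) * (q - a * r))
    - q * ((-c * r) * (p - a * q + (a ^ 2 - b) * r) - (-c * q + a * c * r) * (q - a * r))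
    + r * ((-c * r) * (-b * q + (a * b - c) * r) - (-c * q + a * c * r) * (p - b * r)) := by
    have := coe_intNorm (D.ie p q r)
    rw [coe_ie, norm_el] at this
    exact_mod_cast this
  rw [this]
  rw [Int.abs_eq_natAbs] at h
  exact_mod_cast h

theorem prime_ie (p q r : ℤ) (n : ℕ) (hn : n.Prime)
    (h : Ideal.absNorm (Ideal.span {D.ie p q r}) = n) : Prime (D.ie p q r) := by
  have h0 : D.ie p q r ≠ 0 := by
    intro h0
    rw [h0] at h
    simp at h
    exact hn.ne_zero h.symm
  rw [← Ideal.span_singleton_prime h0]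
  apply Ideal.isPrime_of_irreducible_absNorm
  rw [h]
  exact hn

theorem pid (D : CubicData F a b c) (hd : |a ^ 2 * b ^ 2 - 4 * b ^ 3 - 4 * a ^ 3 * c - 27 * c ^ 2 + 18 * a * b * c| ≤ 76)
    (hd' : a ^ 2 * b ^ 2 - 4 * b ^ 3 - 4 * a ^ 3 * c - 27 * c ^ 2 + 18 * a * b * c < 0)
    (ha : 2 ∣ a) (hb : 2 ∣ b) (hc : |c| = 2) : IsPrincipalIdealRing (𝓞 F) := by
  have hdis := D.abs_discr_le 76 hd
  apply RingOfIntegers.isPrincipalIdealRing_of_isPrincipal_of_norm_le_of_isPrime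
  intro I hI hle
  rw [D.nrComplex hd', D.finrank] at hle
  have hlt : (Ideal.absNorm (I : Ideal (𝓞 F)) : ℝ) < 3 := by
    refine lt_of_le_of_lt hle ?_
    have h9 : √|(discr F : ℝ)| ≤ 9 := by
      rw [Real.sqrt_le_left (by norm_num)]
      have : ((|discr F| : ℤ) : ℝ) ≤ ((76 : ℤ) : ℝ) := by exact_mod_cast hdis
      push_cast at this
      linarith
    have hpi := Real.pi_gt_d2
    have hpi0 : 4 / Real.pi < 4 / 3.14 := by
      apply div_lt_div_of_pos_left <;> linarith
    have : (0:ℝ) < 4 / Real.pi := by positivity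
    norm_num [Nat.factorial]
    nlinarith [Real.sqrt_nonneg |(discr F : ℝ)|]
  have hlt' : Ideal.absNorm (I : Ideal (𝓞 F)) < 3 := by exact_mod_cast hlt
  have hpos : Ideal.absNorm (I : Ideal (𝓞 F)) ≠ 0 := by
    rw [Ne, Ideal.absNorm_eq_zero_iff]
    exact nonZeroDivisors.coe_ne_zero I
  have hne1 : Ideal.absNorm (I : Ideal (𝓞 F)) ≠ 1 := by
    rw [Ne, Ideal.absNorm_eq_one_iff]
    exact hI.ne_top
  have h2 : Ideal.absNorm (I : Ideal (𝓞 F)) = 2 := by omega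
  have h2mem : (2 : 𝓞 F) ∈ (I : Ideal (𝓞 F)) := by
    have := Ideal.absNorm_mem (I : Ideal (𝓞 F))
    rw [h2] at this
    exact_mod_cast this
  have hth : D.ie 0 1 0 ∈ (I : Ideal (𝓞 F)) := by
    apply hI.mem_of_pow_mem 3
    obtain ⟨a', rfl⟩ := ha
    obtain ⟨b', rfl⟩ := hb
    have hc' : ∃ c', c = 2 * c' := by
      rcases abs_choice c with h | h
      · exact ⟨1, by omega⟩
      · exact ⟨-1, by omega⟩
    obtain ⟨c', rfl⟩ := hc'
    have : D.ie 0 1 0 ^ 3 = 2 * (-(a' : 𝓞 F) * D.ie 0 1 0 ^ 2 - b' * D.ie 0 1 0 - c') := by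
      apply RingOfIntegers.ext
      have := D.hθ
      push_cast at this
      have h0 : ((D.ie 0 1 0 : 𝓞 F) : F) = D.θ := by simp [el]
      have e2 : ((2 : 𝓞 F) : F) = 2 := map_ofNat _ 2
      have ei : ∀ n : ℤ, ((n : 𝓞 F) : F) = n := fun n => map_intCast _ n
      simp only [map_pow, map_mul, map_sub, map_neg, h0, this, e2, ei]
      ring
    rw [this]
    exact Ideal.mul_mem_right _ _ h2mem
  have hab : Ideal.absNorm (Ideal.span {D.ie 0 1 0}) = 2 := by
    apply absNorm_ie
    ring_nf
    rw [abs_neg, hc]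
  have hle' : Ideal.span {D.ie 0 1 0} ≤ (I : Ideal (𝓞 F)) := by
    rwa [Ideal.span_singleton_le_iff_mem]
  have heq : Ideal.span {D.ie 0 1 0} = (I : Ideal (𝓞 F)) := by
    obtain ⟨J, hJ⟩ := Ideal.dvd_iff_le.mpr hle'
    rw [hJ]
    have := congrArg Ideal.absNorm hJ
    rw [map_mul, hab, h2] at this
    have hJ1 : Ideal.absNorm J = 1 := by omega
    rw [Ideal.absNorm_eq_one_iff] at hJ1
    rw [hJ1, Ideal.mul_top]
  rw [← heq]
  exact ⟨⟨_, rfl⟩⟩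

end CubicData

end

section
open Polynomial IntermediateField NumberField
open scoped Matrix

theorem even_of_prime_pow_sq {p q : ℕ} (hp : p.Prime) (hq : q.Prime) (hpq : p ≠ q) {i j n s : ℕ}
    (hs : s ≠ 0) (h : s ^ 2 = p ^ i * q ^ j * n ^ 2) : Even i := by
  have := Fact.mk hp
  have := Fact.mk hq
  have hn : n ≠ 0 := by rintro rfl; simp at h; exact hs h
  have h1 := congrArg (padicValNat p) h
  rw [padicValNat.mul (mul_ne_zero (pow_ne_zero _ hp.ne_zero) (pow_ne_zero _ hq.ne_zero))
    (pow_ne_zero _ hn), padicValNat.mul (pow_ne_zero _ hp.ne_zero) (pow_ne_zero _ hq.ne_zero),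
    padicValNat.pow, padicValNat.pow, padicValNat.pow,
    padicValNat.pow, padicValNat_primes hpq, padicValNat_self] at h1
  exact ⟨padicValNat p s - padicValNat p n, by omega⟩

namespace CubicData

variable {F : Type} [Field F] [NumberField F] {a b c : ℤ} (D : CubicData F a b c)

theorem square_class (D : CubicData F a b c)
    (hd : |a ^ 2 * b ^ 2 - 4 * b ^ 3 - 4 * a ^ 3 * c - 27 * c ^ 2 + 18 * a * b * c| ≤ 76)
    (hd' : a ^ 2 * b ^ 2 - 4 * b ^ 3 - 4 * a ^ 3 * c - 27 * c ^ 2 + 18 * a * b * c < 0)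
    (ha : 2 ∣ a) (hb : 2 ∣ b) (hc : |c| = 2)
    (T p1 p2 w : 𝓞 F) (α β γ : ℤ) (hT : T ^ 3 + α * T ^ 2 + β * T + γ = 0)
    (n1 n2 : ℕ) (hn1 : n1.Prime) (hn2 : n2.Prime) (hne : n1 ≠ n2)
    (hp1 : Prime p1) (hp2 : Prime p2)
    (ha1 : (Algebra.norm ℤ p1).natAbs = n1) (ha2 : (Algebra.norm ℤ p2).natAbs = n2)
    (k1 k2 : ℕ) (hgp : (3 * T ^ 2 + 2 * α * T + β) * w = p1 ^ k1 * p2 ^ k2)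
    (u : (𝓞 F)ˣ) (hu : Algebra.norm ℤ (u : 𝓞 F) = 1) (hns : ∀ v : (𝓞 F)ˣ, u ≠ v ^ 2)
    (d r t s : ℤ) (hrt : IsCoprime r t) (hrd : IsCoprime r d)
    (hs : s ^ 2 = r ^ 3 + α * d * r ^ 2 * t ^ 2 + β * d ^ 2 * r * t ^ 4 + γ * d ^ 3 * t ^ 6)
    (hN : Algebra.norm ℤ ((r : 𝓞 F) - d * t ^ 2 * T) = s ^ 2)
    (h0 : (r : 𝓞 F) - d * t ^ 2 * T ≠ 0) :
    ∃ e : 𝓞 F, (r : 𝓞 F) - d * t ^ 2 * T = e ^ 2 ∨ (r : 𝓞 F) - d * t ^ 2 * T = u * e ^ 2 := by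
  have := D.pid hd hd' ha hb hc
  set A : 𝓞 F := (r : 𝓞 F) - d * t ^ 2 * T with hA
  have hs0 : s ≠ 0 := by
    rintro rfl
    have : Algebra.norm ℤ A = 0 := by rw [hN]; norm_num
    exact h0 (Algebra.norm_eq_zero_iff.mp this)
  set Bb : 𝓞 F := (r : 𝓞 F) ^ 2 + (α * d * t ^ 2 + d * t ^ 2 * T) * r +
    (d * t ^ 2) ^ 2 * (β + α * T + T ^ 2) with hB
  have hAB : A * Bb = (s : 𝓞 F) ^ 2 := by
    have : ((s ^ 2 : ℤ) : 𝓞 F) = ((r ^ 3 + α * d * r ^ 2 * t ^ 2 + β * d ^ 2 * r * t ^ 4 + γ * d ^ 3 * t ^ 6 : ℤ) : 𝓞 F) := by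
      rw [hs]
    push_cast at this
    rw [this, hA, hB]
    linear_combination (-(d * t ^ 2 : 𝓞 F) ^ 3) * hT
  have hcast : ∀ {x y : ℤ}, IsCoprime x y → ∀ π : 𝓞 F, Prime π → π ∣ (x : 𝓞 F) → π ∣ (y : 𝓞 F) → False := by
    rintro x y ⟨m, n, hmn⟩ π hπ hx hy
    apply hπ.not_isUnit
    rw [isUnit_iff_dvd_one]
    have : (m : 𝓞 F) * x + n * y = 1 := by exact_mod_cast congrArg (Int.cast : ℤ → 𝓞 F) hmn
    rw [← this]
    exact dvd_add (dvd_mul_of_dvd_right hx _) (dvd_mul_of_dvd_right hy _)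
  obtain ⟨ε, i, j, e, he⟩ := ufd_class p1 p2 A h0 Bb s hAB (by
    intro π hπ hπA hπB
    have hr : ∀ x : 𝓞 F, π ∣ (d * t ^ 2 * T : 𝓞 F) → π ∣ (r : 𝓞 F) := by
      intro _ h
      have := dvd_add hπA h
      rwa [hA, sub_add_cancel] at this
    have h1 : π ∣ ((d : 𝓞 F) * t ^ 2) ^ 2 * (3 * T ^ 2 + 2 * α * T + β) := by
      have : ((d : 𝓞 F) * t ^ 2) ^ 2 * (3 * T ^ 2 + 2 * α * T + β) =
        Bb - A * (r + 2 * d * t ^ 2 * T + α * d * t ^ 2) := by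
        rw [hA, hB]; ring
      rw [this]
      exact dvd_sub hπB (dvd_mul_of_dvd_left hπA _)
    rcases hπ.dvd_or_dvd h1 with h1 | h1
    · exfalso
      rcases hπ.dvd_or_dvd (hπ.dvd_of_dvd_pow h1) with h | h
      · exact hcast hrd π hπ (hr 0 (dvd_mul_of_dvd_left (dvd_mul_of_dvd_left h _) _)) h
      · have h := hπ.dvd_of_dvd_pow h
        exact hcast hrt π hπ (hr 0 (dvd_mul_of_dvd_left (dvd_mul_of_dvd_right (dvd_pow h two_ne_zero) _) _)) h
    · have h2 : π ∣ p1 ^ k1 * p2 ^ k2 := hgp ▸ dvd_mul_of_dvd_left h1 w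
      rcases hπ.dvd_or_dvd h2 with h | h
      · exact Or.inl (hπ.dvd_of_dvd_pow h)
      · exact Or.inr (hπ.dvd_of_dvd_pow h)) hp1 hp2
  have hεa : (Algebra.norm ℤ (ε : 𝓞 F)).natAbs = 1 := by
    rw [← Int.isUnit_iff_natAbs_eq]
    exact ε.isUnit.map _
  have hnorm : s ^ 2 = Algebra.norm ℤ (ε : 𝓞 F) * (Algebra.norm ℤ p1) ^ i * (Algebra.norm ℤ p2) ^ j *
      (Algebra.norm ℤ e) ^ 2 := by
    rw [← hN, he]; simp only [map_mul, map_pow]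
  have hnat := congrArg Int.natAbs hnorm
  simp only [Int.natAbs_mul, Int.natAbs_pow, ha1, ha2, hεa, one_mul] at hnat
  have hi : Even i := even_of_prime_pow_sq hn1 hn2 hne (Int.natAbs_ne_zero.mpr hs0) hnat
  have hj : Even j := even_of_prime_pow_sq hn2 hn1 hne.symm (i := j) (j := i)
    (n := (Algebra.norm ℤ e).natAbs) (s := s.natAbs) (Int.natAbs_ne_zero.mpr hs0)
    (by rw [hnat]; ring)
  obtain ⟨i, rfl⟩ := hi
  obtain ⟨j, rfl⟩ := hj
  have hε1 : Algebra.norm ℤ (ε : 𝓞 F) = 1 := by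
    rcases Int.natAbs_eq (Algebra.norm ℤ (ε : 𝓞 F)) with h | h
    · rw [h, hεa]; rfl
    · exfalso
      rw [h, hεa] at hnorm
      have h1 : 0 < s ^ 2 := by positivity
      have h2 : s ^ 2 = -((Algebra.norm ℤ p1 ^ i) * (Algebra.norm ℤ p2 ^ j) * Algebra.norm ℤ e) ^ 2 := by
        rw [hnorm]; push_cast; ring
      nlinarith [sq_nonneg ((Algebra.norm ℤ p1 ^ i) * (Algebra.norm ℤ p2 ^ j) * Algebra.norm ℤ e)]
  obtain ⟨v, hv | hv⟩ := D.unit_class hd' u hu hns ε hε1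
  · refine ⟨v * p1 ^ i * p2 ^ j * e, Or.inl ?_⟩
    rw [he, hv]; push_cast; ring
  · refine ⟨v * p1 ^ i * p2 ^ j * e, Or.inr ?_⟩
    rw [he, hv]; push_cast; ring

end CubicData

end

section
open Polynomial IntermediateField NumberField
open scoped Matrix

theorem halving_algebra {F : Type*} [Field F] [CharZero F] (T c : F) (α β γ X e0 e1 e2 : ℚ)
    (hT : T ^ 3 + α * T ^ 2 + β * T + γ = 0)
    (hind : ∀ p q r : ℚ, (p : F) + q * T + r * T ^ 2 = 0 → p = 0 ∧ q = 0 ∧ r = 0)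
    (hc : c = e0 + e1 * T + e2 * T ^ 2) (h : c ^ 2 = X - T) :
    ∃ m y : ℚ, y ^ 2 = m ^ 3 + α * m ^ 2 + β * m + γ ∧
      X * (4 * y ^ 2) = m ^ 4 - 2 * β * m ^ 2 - 8 * γ * m + β ^ 2 - 4 * α * γ := by
  have he2 : e2 ≠ 0 := by
    rintro rfl
    obtain ⟨-, h1, h2⟩ := hind (e0 ^ 2 - X) (2 * e0 * e1 + 1) (e1 ^ 2) (by
      push_cast
      rw [hc] at h
      push_cast at h
      linear_combination h)
    have : e1 = 0 := by simpa using h2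
    rw [this] at h1
    norm_num at h1
  set m := e1 / e2 - α with hm
  have hme : m * e2 = e1 - α * e2 := by rw [hm]; field_simp
  set k := m * e1 - e0 + β * e2 with hk
  set n := m * e0 + γ * e2 with hn
  have hmeF : (m : F) * e2 = e1 - α * e2 := by exact_mod_cast congrArg (Rat.cast : ℚ → F) hme
  have hkF : (k : F) = m * e1 - e0 + β * e2 := by rw [hk]; push_cast; ring
  have hnF : (n : F) = m * e0 + γ * e2 := by rw [hn]; push_cast; ring
  have h1 : c * (T - m) = -(k * T + n) := by
    rw [hc, hkF, hnF]
    linear_combination e2 * hT - T ^ 2 * hmeF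
  have h2 : ((X : F) - T) * (T - m) ^ 2 = (k * T + n) ^ 2 := by
    rw [← h]; linear_combination (c * (T - m) - (k * T + n)) * h1
  obtain ⟨q0, q1, q2⟩ := hind (X * m ^ 2 + γ - n ^ 2) (-2 * X * m - m ^ 2 + β - 2 * k * n)
    (X + 2 * m + α - k ^ 2) (by
      push_cast
      linear_combination h2 + hT)
  refine ⟨m, n + k * m, ?_, ?_⟩
  · linear_combination -q0 - m * q1 - m ^ 2 * q2
  · have hy : (n + k * m) ^ 2 = m ^ 3 + α * m ^ 2 + β * m + γ := by
      linear_combination -q0 - m * q1 - m ^ 2 * q2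
    rw [hy]
    linear_combination 4 * (X + 2 * m + α) * q0 + 4 * n ^ 2 * q2 - (β - m ^ 2 - 2 * X * m + 2 * k * n) * q1

theorem clear_denoms (α β γ d : ℤ) (X Y : ℚ)
    (h : Y ^ 2 = X ^ 3 + α * d * X ^ 2 + β * d ^ 2 * X + γ * d ^ 3) :
    ∃ r t s : ℤ, IsCoprime r t ∧ t ≠ 0 ∧ X = r / t ^ 2 ∧
      s ^ 2 = r ^ 3 + α * d * r ^ 2 * t ^ 2 + β * d ^ 2 * r * t ^ 4 + γ * d ^ 3 * t ^ 6 := by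
  set p := X.num with hp
  obtain ⟨q, hq⟩ : ∃ q : ℤ, q = (X.den : ℤ) := ⟨_, rfl⟩
  have hq0 : q ≠ 0 := by rw [hq]; exact_mod_cast X.den_nz
  have hqQ : (q : ℚ) ≠ 0 := by exact_mod_cast hq0
  have hqpos : 0 < q := by rw [hq]; exact_mod_cast X.den_pos
  have hX : X = p / q := by rw [hp, hq]; exact_mod_cast (Rat.num_div_den X).symm
  have hcop : IsCoprime p q := by
    rw [Int.isCoprime_iff_gcd_eq_one]
    rw [hq]
    exact X.reduced
  set M : ℤ := p ^ 3 + α * d * p ^ 2 * q + β * d ^ 2 * p * q ^ 2 + γ * d ^ 3 * q ^ 3 with hM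
  have h1 : ((q * M : ℤ) : ℚ) = (Y * q ^ 2) ^ 2 := by
    rw [mul_pow, h, hX, hM]; push_cast; field_simp
  have h2 : IsSquare (q * M) := by
    rw [← Rat.isSquare_intCast_iff, h1]
    exact ⟨_, sq _⟩
  obtain ⟨S, hS⟩ := h2
  have hcop2 : IsCoprime q M := by
    have h3 : IsCoprime q (p ^ 3) := hcop.symm.pow_right
    have : M = p ^ 3 + q * (α * d * p ^ 2 + β * d ^ 2 * p * q + γ * d ^ 3 * q ^ 2) := by rw [hM]; ring
    rw [this]
    exact h3.add_mul_left_right _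
  obtain ⟨t, ht⟩ := Int.sq_of_isCoprime hcop2 (hS.trans (sq S).symm)
  have ht' : q = t ^ 2 := by
    rcases ht with h | h
    · exact h
    · nlinarith [sq_nonneg t]
  have ht0 : t ≠ 0 := by rintro rfl; exact hq0 (by rw [ht']; norm_num)
  obtain ⟨s, hs⟩ := Int.sq_of_isCoprime hcop2.symm ((mul_comm _ _).trans (hS.trans (sq S).symm))
  have hMnn : 0 ≤ M := by
    by_contra! hneg
    nlinarith [mul_self_nonneg S]
  have hs' : M = s ^ 2 := by
    rcases hs with h | h
    · exact h
    · have : s ^ 2 = 0 := by nlinarith [sq_nonneg s]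
      rw [h, this]; norm_num
  refine ⟨p, t, s, ?_, ht0, ?_, ?_⟩
  · rw [ht'] at hcop
    exact (IsCoprime.pow_right_iff two_pos).mp hcop
  · rw [hX, ht']; push_cast; rfl
  · rw [← hs', hM, ht']; ring

theorem coprime_d (α β γ d r t s : ℤ) (hdp : d = 1 ∨ (Prime d ∧ ∀ r t : ℤ,
      d ∣ r ^ 3 + α * r ^ 2 * t + β * r * t ^ 2 + γ * t ^ 3 → d ∣ t)) (hrt : IsCoprime r t)
    (hs : s ^ 2 = r ^ 3 + α * d * r ^ 2 * t ^ 2 + β * d ^ 2 * r * t ^ 4 + γ * d ^ 3 * t ^ 6) :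
    IsCoprime r d := by
  rcases hdp with rfl | ⟨hp, hd⟩
  · exact isCoprime_one_right
  · rw [isCoprime_comm, hp.irreducible.coprime_iff_not_dvd]
    rintro ⟨r', rfl⟩
    have hd0 := hp.ne_zero
    have h1 : s ^ 2 = d ^ 3 * (r' ^ 3 + α * r' ^ 2 * t ^ 2 + β * r' * (t ^ 2) ^ 2 + γ * (t ^ 2) ^ 3) := by
      rw [hs]; ring
    have h2 : d ∣ s := hp.dvd_of_dvd_pow (h1 ▸ dvd_mul_of_dvd_left (dvd_pow_self d three_ne_zero) _)
    obtain ⟨s', rfl⟩ := h2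
    have h3 : s' ^ 2 = d * (r' ^ 3 + α * r' ^ 2 * t ^ 2 + β * r' * (t ^ 2) ^ 2 + γ * (t ^ 2) ^ 3) := by
      apply mul_left_cancel₀ (pow_ne_zero 2 hd0)
      linear_combination h1
    have h4 : d ∣ s' := hp.dvd_of_dvd_pow (h3 ▸ dvd_mul_right _ _)
    obtain ⟨s'', rfl⟩ := h4
    have h5 : d ∣ r' ^ 3 + α * r' ^ 2 * t ^ 2 + β * r' * (t ^ 2) ^ 2 + γ * (t ^ 2) ^ 3 := by
      refine ⟨s'' ^ 2, ?_⟩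
      apply mul_left_cancel₀ hd0
      linear_combination -h3
    have h6 : d ∣ t := hp.dvd_of_dvd_pow (hd _ _ h5)
    exact hp.not_isUnit (hrt.isUnit_of_dvd' (dvd_mul_right _ _) h6)

namespace CubicData

variable {F : Type} [Field F] [NumberField F] {a b c : ℤ} (D : CubicData F a b c)

theorem halve_generic (T0 T1 T2 s0 s1 s2 : ℚ) (α β γ : ℤ)
    (hT : D.el T0 T1 T2 ^ 3 + α * D.el T0 T1 T2 ^ 2 + β * D.el T0 T1 T2 + γ = 0)
    (hT2 : D.el T0 T1 T2 ^ 2 = D.el s0 s1 s2)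
    (hdet : T1 * s2 - T2 * s1 ≠ 0) (d : ℤ) (hd0 : d ≠ 0)
    (hdp : d = 1 ∨ (Prime d ∧ ∀ r t : ℤ,
      d ∣ r ^ 3 + α * r ^ 2 * t + β * r * t ^ 2 + γ * t ^ 3 → d ∣ t))
    (hcls : ∀ r t s : ℤ, IsCoprime r t → IsCoprime r d → t ≠ 0 →
      s ^ 2 = r ^ 3 + α * d * r ^ 2 * t ^ 2 + β * d ^ 2 * r * t ^ 4 + γ * d ^ 3 * t ^ 6 →
      ∃ e : F, (r : F) - d * t ^ 2 * D.el T0 T1 T2 = e ^ 2)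
    (X Y : ℚ) (h : Y ^ 2 = X ^ 3 + α * d * X ^ 2 + β * d ^ 2 * X + γ * d ^ 3) :
    ∃ m y : ℚ, y ^ 2 = m ^ 3 + α * d * m ^ 2 + β * d ^ 2 * m + γ * d ^ 3 ∧
      X * (4 * y ^ 2) = m ^ 4 - 2 * (β * d ^ 2) * m ^ 2 - 8 * (γ * d ^ 3) * m +
        (β * d ^ 2) ^ 2 - 4 * (α * d) * (γ * d ^ 3) := by
  obtain ⟨r, t, s, hrt, ht0, hX, hs⟩ := clear_denoms α β γ d X Y h
  have hrd := coprime_d α β γ d r t s hdp hrt hs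
  obtain ⟨e, he⟩ := hcls r t s hrt hrd ht0 hs
  have htF : (t : F) ≠ 0 := by exact_mod_cast ht0
  have hdQ : (d : ℚ) ≠ 0 := by exact_mod_cast hd0
  set Θ := D.el T0 T1 T2 with hΘ
  have hspan : ∀ x : F, ∃ e0 e1 e2 : ℚ, x = e0 + e1 * (d * Θ) + e2 * (d * Θ) ^ 2 := by
    intro x
    obtain ⟨p, q, r, rfl⟩ := D.exists_el x
    set f1 := (q * s2 - r * s1) / (T1 * s2 - T2 * s1) with hf1
    set f2 := (r * T1 - q * T2) / (T1 * s2 - T2 * s1) with hf2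
    have g1 : f1 * T1 + f2 * s1 = q := by
      rw [hf1, hf2, div_mul_eq_mul_div, div_mul_eq_mul_div, ← add_div, div_eq_iff hdet]; ring
    have g2 : f1 * T2 + f2 * s2 = r := by
      rw [hf1, hf2, div_mul_eq_mul_div, div_mul_eq_mul_div, ← add_div, div_eq_iff hdet]; ring
    refine ⟨p - f1 * T0 - f2 * s0, f1 / d, f2 / d ^ 2, ?_⟩
    rw [mul_pow, hT2, hΘ]
    have hdF : (d : F) ≠ 0 := by exact_mod_cast hd0
    have i1 : ((f1 / d : ℚ) : F) * (d * D.el T0 T1 T2) = f1 * D.el T0 T1 T2 := by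
      push_cast; field_simp
    have i2 : ((f2 / d ^ 2 : ℚ) : F) * (d ^ 2 * D.el s0 s1 s2) = f2 * D.el s0 s1 s2 := by
      push_cast; field_simp
    rw [i1, i2]
    rw [← g1, ← g2]
    simp only [el]
    push_cast
    ring
  have hind : ∀ p q r : ℚ, (p : F) + q * (d * Θ) + r * (d * Θ) ^ 2 = 0 → p = 0 ∧ q = 0 ∧ r = 0 := by
    intro p q r h0
    have h1 : D.el (p + q * d * T0 + r * d ^ 2 * s0) (q * d * T1 + r * d ^ 2 * s1)
      (q * d * T2 + r * d ^ 2 * s2) = D.el 0 0 0 := by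
      rw [mul_pow, hT2, hΘ] at h0
      simp only [el] at h0 ⊢
      push_cast
      linear_combination h0
    obtain ⟨g0, g1, g2⟩ := D.el_inj h1
    have hr : r = 0 := by
      have : r * (d ^ 2 * (T1 * s2 - T2 * s1)) = 0 := by linear_combination T1 * g2 - T2 * g1
      rcases mul_eq_zero.mp this with h | h
      · exact h
      · exact absurd h (mul_ne_zero (pow_ne_zero 2 hdQ) hdet)
    subst hr
    have hq : q = 0 := by
      have : q * (d * (T1 * s2 - T2 * s1)) = 0 := by linear_combination s2 * g1 - s1 * g2
      rcases mul_eq_zero.mp this with h | h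
      · exact h
      · exact absurd h (mul_ne_zero hdQ hdet)
    subst hq
    exact ⟨by simpa using g0, rfl, rfl⟩
  obtain ⟨e0, e1, e2, hc⟩ := hspan (e / t)
  have hTd : (d * Θ) ^ 3 + ((α * d : ℚ) : F) * (d * Θ) ^ 2 + ((β * d ^ 2 : ℚ) : F) * (d * Θ) +
      ((γ * d ^ 3 : ℚ) : F) = 0 := by
    push_cast
    linear_combination (d : F) ^ 3 * hT
  exact halving_algebra (d * Θ) (e / t) (α * d) (β * d ^ 2) (γ * d ^ 3) X e0 e1 e2 hTd hind hc (by
    rw [hX, div_pow, ← he]; push_cast; field_simp)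

end CubicData

/-- Existence of a cubic field with prescribed Eisenstein minimal polynomial. -/
theorem exists_cubicData (a b c : ℤ) (ha : 2 ∣ a) (hb : 2 ∣ b) (hc : 2 ∣ c) (hc4 : ¬ 4 ∣ c) :
    ∃ (F : Type) (_ : Field F) (_ : NumberField F), Nonempty (CubicData F a b c) := by
  set f : ℤ[X] := X ^ 3 + (C a * X ^ 2 + C b * X + C c) with hf
  have hmon : f.Monic := by rw [hf]; monicity!
  have hdeg : f.natDegree = 3 := by rw [hf]; compute_degree!
  have hirr : Irreducible f := by
    apply Polynomial.irreducible_of_eisenstein_criterion (P := Ideal.span {(2 : ℤ)})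
    · rw [Ideal.span_singleton_prime (by norm_num)]; exact Int.prime_two
    · rw [hmon.leadingCoeff, Ideal.mem_span_singleton]; norm_num
    · intro n hn
      rw [Polynomial.degree_eq_natDegree hmon.ne_zero, hdeg] at hn
      have hn : n < 3 := by exact_mod_cast hn
      rw [Ideal.mem_span_singleton]
      interval_cases n <;> simp [hf, coeff_X, coeff_C, coeff_X_pow, -eq_intCast] <;> assumption
    · rw [Polynomial.degree_eq_natDegree hmon.ne_zero, hdeg]; norm_num
    · rw [Ideal.span_singleton_pow, Ideal.mem_span_singleton]
      simpa [hf, coeff_X, coeff_C, coeff_X_pow, -eq_intCast] using hc4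
    · exact hmon.isPrimitive
  set g : ℚ[X] := f.map (Int.castRingHom ℚ) with hg
  have hgmon : g.Monic := hmon.map _
  have hgdeg : g.natDegree = 3 := by rw [hg, hmon.natDegree_map, hdeg]
  have hgirr : Irreducible g :=
    (hmon.isPrimitive.irreducible_iff_irreducible_map_fraction_map (K := ℚ)).mp hirr
  have : Fact (Irreducible g) := ⟨hgirr⟩
  refine ⟨AdjoinRoot g, inferInstance, inferInstance, ?_⟩
  let pb := AdjoinRoot.powerBasis hgirr.ne_zero
  have hdim : pb.dim = 3 := by
    rw [AdjoinRoot.powerBasis_dim, hgdeg]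
  have hgen : pb.gen = AdjoinRoot.root g := AdjoinRoot.powerBasis_gen _
  refine ⟨⟨AdjoinRoot.root g, pb.basis.reindex (finCongr hdim), ?_, ?_, ?_, ?_⟩⟩
  · simp
  · simp [hgen]
  · simp [hgen]
  · have := AdjoinRoot.eval₂_root g
    have hgf : g = X ^ 3 + (C (a : ℚ) * X ^ 2 + C (b : ℚ) * X + C (c : ℚ)) := by
      rw [hg, hf]
      simp only [Polynomial.map_add, Polynomial.map_mul, Polynomial.map_pow, map_X, map_C,
        Int.coe_castRingHom]
    have h3 : eval₂ (AdjoinRoot.of g) (AdjoinRoot.root g)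
        (X ^ 3 + (C (a : ℚ) * X ^ 2 + C (b : ℚ) * X + C (c : ℚ))) = 0 := by
      rw [← hgf]; exact this
    simp only [eval₂_add, eval₂_mul, eval₂_pow, eval₂_X, eval₂_C] at h3
    simp only [map_intCast] at h3
    linear_combination h3

end

section
open Polynomial IntermediateField NumberField
open scoped Matrix

theorem zmod4_even (x : ℤ) (h : (2 : ZMod 4) * (x : ZMod 4) = 0) : ∃ y, x = 2 * y := by
  have h1 : ((2 * x : ℤ) : ZMod 4) = 0 := by push_cast; exact h
  rw [ZMod.intCast_zmod_eq_zero_iff_dvd] at h1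
  push_cast at h1
  exact ⟨x / 2, by omega⟩

theorem zmod4_odd (d : ℤ) (h : Odd d) : (d : ZMod 4) = 1 ∨ (d : ZMod 4) = 3 := by
  have h1 : d % 4 = 1 ∨ d % 4 = 3 := by obtain ⟨k, rfl⟩ := h; omega
  rcases h1 with h1 | h1
  · left
    have := (ZMod.intCast_eq_intCast_iff' d 1 4).mpr (by push_cast; omega)
    exact_mod_cast this
  · right
    have := (ZMod.intCast_eq_intCast_iff' d 3 4).mpr (by push_cast; omega)
    exact_mod_cast this

namespace CubicData
variable {F : Type} [Field F] [NumberField F] {a b c : ℤ} (D : CubicData F a b c)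

theorem ie_eq (p q r : ℤ) : D.ie p q r = p + q * D.ie 0 1 0 + r * D.ie 0 1 0 ^ 2 := by
  apply RingOfIntegers.ext
  have ei : ∀ n : ℤ, ((n : 𝓞 F) : F) = n := fun n => map_intCast _ n
  simp only [map_add, map_mul, map_pow, coe_ie, ei]
  simp [el]

theorem ie_rel : D.ie 0 1 0 ^ 3 + a * D.ie 0 1 0 ^ 2 + b * D.ie 0 1 0 + c = 0 := by
  apply RingOfIntegers.ext
  have ei : ∀ n : ℤ, ((n : 𝓞 F) : F) = n := fun n => map_intCast _ n
  simp only [map_add, map_mul, map_pow, coe_ie, ei, map_zero]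
  have : D.el ((0 : ℤ) : ℚ) ((1 : ℤ) : ℚ) ((0 : ℤ) : ℚ) = D.θ := by simp [el]
  rw [this, D.hθ]
  ring

theorem norm_ie (p q r : ℤ) : Algebra.norm ℤ (D.ie p q r) =
    p * ((p - b * r) * (p - a * q + (a ^ 2 - b) * r) - (-b * q + (a * b - c) * r) * (q - a * r))
    - q * ((-c * r) * (p - a * q + (a ^ 2 - b) * r) - (-c * q + a * c * r) * (q - a * r))
    + r * ((-c * r) * (-b * q + (a * b - c) * r) - (-c * q + a * c * r) * (p - b * r)) := by
  have := coe_intNorm (D.ie p q r)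
  rw [coe_ie, norm_el] at this
  exact_mod_cast this

end CubicData
/-- cubic -/
def G11 (x : ℚ) : ℚ := 4 * x ^ 3 - 4 * x ^ 2 - 40 * x - 79
/-- quartic -/
def F11 (x : ℚ) : ℚ := x ^ 4 + 20 * x ^ 2 + 158 * x + 21

/-- first form -/
def formA11 {R : Type*} [CommRing R] (x y z : R) : R := -(x ^ 2 - 4 * y * z + 4 * z ^ 2) - (2 * x * y - 4 * y * z + 2 * z ^ 2) + 2 * (2 * x * z + y ^ 2 - 4 * y * z + 2 * z ^ 2)
/-- second form -/
def formB11 {R : Type*} [CommRing R] (x y z : R) : R := (2 * x * z + y ^ 2 - 4 * y * z + 2 * z ^ 2) - (2 * x * y - 4 * y * z + 2 * z ^ 2)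

theorem excl_mod11 : ∀ d x y z w : ZMod 4, (d = 1 ∨ d = 3) → formA11 x y z = (2) * d * w ^ 2 →
    formB11 x y z = (-6) * d * w ^ 2 → 2 * x = 0 ∧ 2 * y = 0 ∧ 2 * z = 0 ∧ 2 * w = 0 := by
  unfold formA11 formB11
  decide +kernel

theorem excl_int11 (d : ℤ) (hd : Odd d) (n : ℕ) : ∀ x y z w : ℤ,
    x.natAbs + y.natAbs + z.natAbs + w.natAbs ≤ n →
    formA11 x y z = (2) * d * w ^ 2 → formB11 x y z = (-6) * d * w ^ 2 →
    x = 0 ∧ y = 0 ∧ z = 0 ∧ w = 0 := by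
  induction n with
  | zero => intro x y z w h _ _; omega
  | succ n ih =>
    intro x y z w hn hA hB
    by_cases h0 : x = 0 ∧ y = 0 ∧ z = 0 ∧ w = 0
    · exact h0
    have hA4 := congrArg (Int.cast : ℤ → ZMod 4) hA
    have hB4 := congrArg (Int.cast : ℤ → ZMod 4) hB
    simp only [formA11, formB11] at hA4 hB4
    push_cast at hA4 hB4
    obtain ⟨h1, h2, h3, h4⟩ := excl_mod11 d x y z w (zmod4_odd d hd) hA4 hB4
    obtain ⟨x, rfl⟩ := zmod4_even x h1
    obtain ⟨y, rfl⟩ := zmod4_even y h2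
    obtain ⟨z, rfl⟩ := zmod4_even z h3
    obtain ⟨w, rfl⟩ := zmod4_even w h4
    have := ih x y z w (by omega) (by simp only [formA11] at hA ⊢; linarith)
      (by simp only [formB11] at hB ⊢; linarith)
    omega

theorem excl_rat11 (d : ℤ) (hd : Odd d) (x y z w : ℚ)
    (hA : formA11 x y z = (2) * d * w ^ 2) (hB : formB11 x y z = (-6) * d * w ^ 2) :
    x = 0 ∧ y = 0 ∧ z = 0 ∧ w = 0 := by
  have hx : (x.num : ℚ) = x * x.den := (Rat.mul_den_eq_num x).symm
  have hy : (y.num : ℚ) = y * y.den := (Rat.mul_den_eq_num y).symm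
  have hz : (z.num : ℚ) = z * z.den := (Rat.mul_den_eq_num z).symm
  have hw : (w.num : ℚ) = w * w.den := (Rat.mul_den_eq_num w).symm
  have hx0 : (x.den : ℚ) ≠ 0 := by exact_mod_cast x.den_nz
  have hy0 : (y.den : ℚ) ≠ 0 := by exact_mod_cast y.den_nz
  have hz0 : (z.den : ℚ) ≠ 0 := by exact_mod_cast z.den_nz
  have hw0 : (w.den : ℚ) ≠ 0 := by exact_mod_cast w.den_nz
  set N : ℚ := x.den * y.den * z.den * w.den with hN
  have hN0 : N ≠ 0 := by rw [hN]; exact mul_ne_zero (mul_ne_zero (mul_ne_zero hx0 hy0) hz0) hw0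
  have ex : ((x.num * y.den * z.den * w.den : ℤ) : ℚ) = N * x := by
    push_cast; rw [hN, hx]; ring
  have ey : ((y.num * x.den * z.den * w.den : ℤ) : ℚ) = N * y := by
    push_cast; rw [hN, hy]; ring
  have ez : ((z.num * x.den * y.den * w.den : ℤ) : ℚ) = N * z := by
    push_cast; rw [hN, hz]; ring
  have ew : ((w.num * x.den * y.den * z.den : ℤ) : ℚ) = N * w := by
    push_cast; rw [hN, hw]; ring
  generalize (x.num * y.den * z.den * w.den : ℤ) = x' at ex
  generalize (y.num * x.den * z.den * w.den : ℤ) = y' at ey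
  generalize (z.num * x.den * y.den * w.den : ℤ) = z' at ez
  generalize (w.num * x.den * y.den * z.den : ℤ) = w' at ew
  obtain ⟨h1, h2, h3, h4⟩ := excl_int11 d hd _ x' y' z' w' le_rfl
    (by
      have : ((formA11 x' y' z' : ℤ) : ℚ) = (((2) * d * w' ^ 2 : ℤ) : ℚ) := by
        simp only [formA11] at hA ⊢
        push_cast
        rw [ex, ey, ez, ew]
        linear_combination N ^ 2 * hA
      exact_mod_cast this)
    (by
      have : ((formB11 x' y' z' : ℤ) : ℚ) = (((-6) * d * w' ^ 2 : ℤ) : ℚ) := by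
        simp only [formB11] at hB ⊢
        push_cast
        rw [ex, ey, ez, ew]
        linear_combination N ^ 2 * hB
      exact_mod_cast this)
  subst h1 h2 h3 h4
  push_cast at ex ey ez ew
  refine ⟨?_, ?_, ?_, ?_⟩
  · exact (mul_eq_zero.mp ex.symm).resolve_left hN0
  · exact (mul_eq_zero.mp ey.symm).resolve_left hN0
  · exact (mul_eq_zero.mp ez.symm).resolve_left hN0
  · exact (mul_eq_zero.mp ew.symm).resolve_left hN0

theorem class11 {F : Type} [Field F] [NumberField F] (D : CubicData F 2 2 2) (d : ℤ) (hd : Odd d)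
    (r t s : ℤ) (hrt : IsCoprime r t) (hrd : IsCoprime r d) (ht : t ≠ 0)
    (hs : s ^ 2 = r ^ 3 + (-4 : ℤ) * d * r ^ 2 * t ^ 2 + (-160 : ℤ) * d ^ 2 * r * t ^ 4 + (-1264 : ℤ) * d ^ 3 * t ^ 6) :
    ∃ e : F, (r : F) - d * t ^ 2 * D.el 0 (-2) 6 = e ^ 2 := by
  have hd0 : d ≠ 0 := by rintro rfl; revert hd; decide
  have hrel := D.ie_rel
  push_cast at hrel
  have hT : D.ie 0 (-2) 6 ^ 3 + ((-4 : ℤ) : 𝓞 F) * D.ie 0 (-2) 6 ^ 2 + ((-160 : ℤ) : 𝓞 F) * D.ie 0 (-2) 6 + ((-1264 : ℤ) : 𝓞 F) = 0 := by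
    rw [D.ie_eq 0 (-2) 6]
    generalize D.ie 0 1 0 = th at hrel ⊢
    push_cast
    linear_combination ((-632) * th ^ 0 + (792) * th ^ 1 + (-648) * th ^ 2 + (216) * th ^ 3) * hrel
  have hgp : (3 * D.ie 0 (-2) 6 ^ 2 + 2 * ((-4 : ℤ) : 𝓞 F) * D.ie 0 (-2) 6 + ((-160 : ℤ) : 𝓞 F)) * D.ie (-9) (-12) (-4) =
      D.ie 0 1 0 ^ 8 * D.ie 1 (-2) (-2) ^ 5 := by
    rw [D.ie_eq 0 (-2) 6, D.ie_eq (-9) (-12) (-4), D.ie_eq 1 (-2) (-2)]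
    generalize D.ie 0 1 0 = th at hrel ⊢
    push_cast
    linear_combination ((720) * th ^ 0 + (168) * th ^ 1 + (-502) * th ^ 2 + (482) * th ^ 3 + (-46) * th ^ 4 + (-689) * th ^ 5 + (278) * th ^ 6 + (434) * th ^ 7 + (-368) * th ^ 8 + (-200) * th ^ 9 + (336) * th ^ 10 + (48) * th ^ 11 + (-224) * th ^ 12 + (-16) * th ^ 13 + (96) * th ^ 14 + (32) * th ^ 15) * hrel
  have huu : D.ie (-1) (-1) 0 * D.ie 1 1 1 = 1 := by
    rw [D.ie_eq (-1) (-1) 0, D.ie_eq 1 1 1]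
    generalize D.ie 0 1 0 = th at hrel ⊢
    push_cast
    linear_combination (-1) * hrel
  let u : (𝓞 F)ˣ := ⟨D.ie (-1) (-1) 0, D.ie 1 1 1, huu, (mul_comm _ _).trans huu⟩
  have hu1 : Algebra.norm ℤ (u : 𝓞 F) = 1 := by
    change Algebra.norm ℤ (D.ie (-1) (-1) 0) = 1
    rw [D.norm_ie]; norm_num
  have hform : ∀ x y z : ℚ, ∃ m : ℚ, D.el (-1) (-1) 0 * D.el x y z ^ 2 = D.el m (formA11 x y z) (formB11 x y z) := by
    intro x y z
    refine ⟨-(x ^ 2 - 4 * y * z + 4 * z ^ 2) + 2 * (2 * x * z + y ^ 2 - 4 * y * z + 2 * z ^ 2), ?_⟩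
    rw [sq, D.el_mul, D.el_mul]
    simp only [formA11, formB11]
    congr 1 <;> push_cast <;> ring
  have hcoe : ((u : 𝓞 F) : F) = D.el (-1) (-1) 0 := by
    change ((D.ie (-1) (-1) 0 : 𝓞 F) : F) = _
    rw [D.coe_ie]; norm_num
  have hns : ∀ v : (𝓞 F)ˣ, u ≠ v ^ 2 := by
    intro v hv
    have h1 : (u : 𝓞 F) * ((v⁻¹ : (𝓞 F)ˣ) : 𝓞 F) ^ 2 = 1 := by
      rw [hv, ← Units.val_pow_eq_pow_val, ← Units.val_mul, ← mul_pow, mul_inv_cancel]; simp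
    have h2 := congrArg (fun x : 𝓞 F => (x : F)) h1
    simp only [map_mul, map_pow, hcoe, map_one] at h2
    obtain ⟨x, y, z, hxyz⟩ := D.exists_el (algebraMap (𝓞 F) F ((v⁻¹ : (𝓞 F)ˣ) : 𝓞 F))
    rw [hxyz] at h2
    obtain ⟨m, hm⟩ := hform x y z
    rw [hm] at h2
    have h3 : (1 : F) = D.el 1 0 0 := by simp [CubicData.el]
    rw [h3] at h2
    obtain ⟨g0, g1, g2⟩ := D.el_inj h2
    obtain ⟨rfl, rfl, rfl, -⟩ := excl_rat11 1 odd_one x y z 0 (by rw [g1]; norm_num) (by rw [g2]; norm_num)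
    have h4 : (algebraMap (𝓞 F) F ((v⁻¹ : (𝓞 F)ˣ) : 𝓞 F)) = 0 := by rw [hxyz]; simp [CubicData.el]
    have h5 : ((v⁻¹ : (𝓞 F)ˣ) : 𝓞 F) = 0 := RingOfIntegers.ext (h4.trans (map_zero (algebraMap (𝓞 F) F)).symm)
    exact (v⁻¹).ne_zero h5
  have hel : (r : 𝓞 F) - d * t ^ 2 * D.ie 0 (-2) 6 = D.ie (r - d * t ^ 2 * (0)) (- d * t ^ 2 * (-2)) (- d * t ^ 2 * (6)) := by
    rw [D.ie_eq 0 (-2) 6, D.ie_eq (r - d * t ^ 2 * (0))]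
    push_cast
    ring
  have hNs : Algebra.norm ℤ ((r : 𝓞 F) - d * t ^ 2 * D.ie 0 (-2) 6) = s ^ 2 := by
    rw [hel, D.norm_ie, hs]; ring
  have hne : (r : 𝓞 F) - d * t ^ 2 * D.ie 0 (-2) 6 ≠ 0 := by
    intro h0
    rw [hel] at h0
    have h1 := congrArg (fun x : 𝓞 F => (x : F)) h0
    simp only [D.coe_ie, map_zero] at h1
    have h3 : (0 : F) = D.el 0 0 0 := by simp [CubicData.el]
    rw [h3] at h1
    obtain ⟨-, g1, -⟩ := D.el_inj h1
    have g1 : (- d * t ^ 2 * (-2)) = 0 := by exact_mod_cast g1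
    have : d * t ^ 2 ≠ 0 := mul_ne_zero hd0 (pow_ne_zero 2 ht)
    apply this
    linarith
  have n1 : Ideal.absNorm (Ideal.span {D.ie 0 1 0}) = 2 := D.absNorm_ie _ _ _ _ (by norm_num)
  have n2 : Ideal.absNorm (Ideal.span {D.ie 1 (-2) (-2)}) = 11 := D.absNorm_ie _ _ _ _ (by norm_num)
  have hT1 : ((D.ie 0 (-2) 6 : 𝓞 F) : F) = D.el 0 (-2) 6 := by rw [D.coe_ie]; norm_num
  have hTF : (((r : 𝓞 F) - d * t ^ 2 * D.ie 0 (-2) 6 : 𝓞 F) : F) = (r : F) - d * t ^ 2 * D.el 0 (-2) 6 := by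
    rw [← hT1]; simp only [map_sub, map_mul, map_pow, map_intCast]
  obtain ⟨e, he | he⟩ := D.square_class (by norm_num) (by norm_num) (by norm_num) (by norm_num) (by norm_num)
    (D.ie 0 (-2) 6) (D.ie 0 1 0) (D.ie 1 (-2) (-2)) (D.ie (-9) (-12) (-4)) _ _ _ hT 2 11 (by norm_num) (by norm_num) (by norm_num)
    (D.prime_ie _ _ _ 2 (by norm_num) n1) (D.prime_ie _ _ _ 11 (by norm_num) n2)
    (by rw [← Ideal.absNorm_span_singleton, n1]) (by rw [← Ideal.absNorm_span_singleton, n2])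
    8 5 hgp u hu1 hns d r t s hrt hrd hs hNs hne
  · refine ⟨e, ?_⟩
    rw [← hTF, he]; simp
  · exfalso
    have h1 := congrArg (fun x : 𝓞 F => (x : F)) he
    simp only [map_mul, map_pow, hcoe] at h1
    rw [hTF] at h1
    obtain ⟨x, y, z, hxyz⟩ := D.exists_el (algebraMap (𝓞 F) F e)
    obtain ⟨m, hm⟩ := hform x y z
    rw [hxyz, hm] at h1
    have h2 : (r : F) - d * t ^ 2 * D.el 0 (-2) 6 = D.el (r - d * t ^ 2 * (0)) (- d * t ^ 2 * (-2)) (- d * t ^ 2 * (6)) := by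
      simp only [CubicData.el]; push_cast; ring
    rw [h2] at h1
    obtain ⟨-, g1, g2⟩ := D.el_inj h1
    obtain ⟨-, -, -, h0⟩ := excl_rat11 d hd x y z t (by rw [← g1]; ring) (by rw [← g2]; ring)
    exact ht (by exact_mod_cast h0)

theorem halve11 (d : ℤ) (hd : Odd d) (hdp : d = 1 ∨ (Prime d ∧ ∀ r t : ℤ,
      d ∣ r ^ 3 + (-4 : ℤ) * r ^ 2 * t + (-160 : ℤ) * r * t ^ 2 + (-1264 : ℤ) * t ^ 3 → d ∣ t))
    (x v : ℚ) (h : d * v ^ 2 = G11 x) :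
    ∃ m y : ℚ, d * y ^ 2 = G11 m ∧ x * G11 m = F11 m := by
  have hd0 : d ≠ 0 := by rintro rfl; revert hd; decide
  have hdQ : (d : ℚ) ≠ 0 := by exact_mod_cast hd0
  obtain ⟨F, _, _, ⟨D⟩⟩ := exists_cubicData 2 2 2 (by norm_num) (by norm_num) (by norm_num) (by norm_num)
  have hrel := D.hθ
  push_cast at hrel
  obtain ⟨m, y, h1, h2⟩ := D.halve_generic 0 (-2) 6 192 120 124 (-4) (-160) (-1264)
    (by
      simp only [CubicData.el]
      generalize D.θ = th at hrel ⊢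
      push_cast
      linear_combination ((-632) * th ^ 0 + (792) * th ^ 1 + (-648) * th ^ 2 + (216) * th ^ 3) * hrel)
    (by
      rw [sq, D.el_mul]
      congr 1 <;> norm_num) (by norm_num) d hd0 hdp
    (fun r t s hrt hrd ht hs => class11 D d hd r t s hrt hrd ht hs) (4 * d * x) (4 * d ^ 2 * v)
    (by
      simp only [G11] at h
      push_cast
      linear_combination 16 * d ^ 3 * h)
  push_cast at h1 h2
  have hm : m = 4 * d * (m / (4 * d)) := by field_simp
  have hy : y = 4 * d ^ 2 * (y / (4 * d ^ 2)) := by field_simp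
  generalize m / (4 * d) = m' at hm
  generalize y / (4 * d ^ 2) = y' at hy
  have h3 : d * y' ^ 2 = G11 m' := by
    simp only [G11]
    apply mul_left_cancel₀ (mul_ne_zero (by norm_num : (16 : ℚ) ≠ 0) (pow_ne_zero 3 hdQ))
    rw [hm, hy] at h1
    linear_combination h1
  refine ⟨m', y', h3, ?_⟩
  rw [← h3]
  simp only [F11]
  apply mul_left_cancel₀ (mul_ne_zero (by norm_num : (256 : ℚ) ≠ 0) (pow_ne_zero 4 hdQ))
  rw [hm, hy] at h2
  linear_combination h2
/-- cubic -/
def G19 (x : ℚ) : ℚ := 4 * x ^ 3 + 4 * x ^ 2 - 36 * x - 59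
/-- quartic -/
def F19 (x : ℚ) : ℚ := x ^ 4 + 18 * x ^ 2 + 118 * x + 140

/-- first form -/
def formA19 {R : Type*} [CommRing R] (x y z : R) : R := (x ^ 2 + 4 * y * z) + (2 * x * y + 4 * y * z + 2 * z ^ 2) + 2 * (2 * x * z + y ^ 2 + 2 * z ^ 2)
/-- second form -/
def formB19 {R : Type*} [CommRing R] (x y z : R) : R := (2 * x * y + 4 * y * z + 2 * z ^ 2) + (2 * x * z + y ^ 2 + 2 * z ^ 2)

theorem excl_mod19 : ∀ d x y z w : ZMod 4, (d = 1 ∨ d = 3) → formA19 x y z = (-6) * d * w ^ 2 →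
    formB19 x y z = (-2) * d * w ^ 2 → 2 * x = 0 ∧ 2 * y = 0 ∧ 2 * z = 0 ∧ 2 * w = 0 := by
  unfold formA19 formB19
  decide +kernel

theorem excl_int19 (d : ℤ) (hd : Odd d) (n : ℕ) : ∀ x y z w : ℤ,
    x.natAbs + y.natAbs + z.natAbs + w.natAbs ≤ n →
    formA19 x y z = (-6) * d * w ^ 2 → formB19 x y z = (-2) * d * w ^ 2 →
    x = 0 ∧ y = 0 ∧ z = 0 ∧ w = 0 := by
  induction n with
  | zero => intro x y z w h _ _; omega
  | succ n ih =>
    intro x y z w hn hA hB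
    by_cases h0 : x = 0 ∧ y = 0 ∧ z = 0 ∧ w = 0
    · exact h0
    have hA4 := congrArg (Int.cast : ℤ → ZMod 4) hA
    have hB4 := congrArg (Int.cast : ℤ → ZMod 4) hB
    simp only [formA19, formB19] at hA4 hB4
    push_cast at hA4 hB4
    obtain ⟨h1, h2, h3, h4⟩ := excl_mod19 d x y z w (zmod4_odd d hd) hA4 hB4
    obtain ⟨x, rfl⟩ := zmod4_even x h1
    obtain ⟨y, rfl⟩ := zmod4_even y h2
    obtain ⟨z, rfl⟩ := zmod4_even z h3
    obtain ⟨w, rfl⟩ := zmod4_even w h4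
    have := ih x y z w (by omega) (by simp only [formA19] at hA ⊢; linarith)
      (by simp only [formB19] at hB ⊢; linarith)
    omega

theorem excl_rat19 (d : ℤ) (hd : Odd d) (x y z w : ℚ)
    (hA : formA19 x y z = (-6) * d * w ^ 2) (hB : formB19 x y z = (-2) * d * w ^ 2) :
    x = 0 ∧ y = 0 ∧ z = 0 ∧ w = 0 := by
  have hx : (x.num : ℚ) = x * x.den := (Rat.mul_den_eq_num x).symm
  have hy : (y.num : ℚ) = y * y.den := (Rat.mul_den_eq_num y).symm
  have hz : (z.num : ℚ) = z * z.den := (Rat.mul_den_eq_num z).symm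
  have hw : (w.num : ℚ) = w * w.den := (Rat.mul_den_eq_num w).symm
  have hx0 : (x.den : ℚ) ≠ 0 := by exact_mod_cast x.den_nz
  have hy0 : (y.den : ℚ) ≠ 0 := by exact_mod_cast y.den_nz
  have hz0 : (z.den : ℚ) ≠ 0 := by exact_mod_cast z.den_nz
  have hw0 : (w.den : ℚ) ≠ 0 := by exact_mod_cast w.den_nz
  set N : ℚ := x.den * y.den * z.den * w.den with hN
  have hN0 : N ≠ 0 := by rw [hN]; exact mul_ne_zero (mul_ne_zero (mul_ne_zero hx0 hy0) hz0) hw0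
  have ex : ((x.num * y.den * z.den * w.den : ℤ) : ℚ) = N * x := by
    push_cast; rw [hN, hx]; ring
  have ey : ((y.num * x.den * z.den * w.den : ℤ) : ℚ) = N * y := by
    push_cast; rw [hN, hy]; ring
  have ez : ((z.num * x.den * y.den * w.den : ℤ) : ℚ) = N * z := by
    push_cast; rw [hN, hz]; ring
  have ew : ((w.num * x.den * y.den * z.den : ℤ) : ℚ) = N * w := by
    push_cast; rw [hN, hw]; ring
  generalize (x.num * y.den * z.den * w.den : ℤ) = x' at ex
  generalize (y.num * x.den * z.den * w.den : ℤ) = y' at ey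
  generalize (z.num * x.den * y.den * w.den : ℤ) = z' at ez
  generalize (w.num * x.den * y.den * z.den : ℤ) = w' at ew
  obtain ⟨h1, h2, h3, h4⟩ := excl_int19 d hd _ x' y' z' w' le_rfl
    (by
      have : ((formA19 x' y' z' : ℤ) : ℚ) = (((-6) * d * w' ^ 2 : ℤ) : ℚ) := by
        simp only [formA19] at hA ⊢
        push_cast
        rw [ex, ey, ez, ew]
        linear_combination N ^ 2 * hA
      exact_mod_cast this)
    (by
      have : ((formB19 x' y' z' : ℤ) : ℚ) = (((-2) * d * w' ^ 2 : ℤ) : ℚ) := by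
        simp only [formB19] at hB ⊢
        push_cast
        rw [ex, ey, ez, ew]
        linear_combination N ^ 2 * hB
      exact_mod_cast this)
  subst h1 h2 h3 h4
  push_cast at ex ey ez ew
  refine ⟨?_, ?_, ?_, ?_⟩
  · exact (mul_eq_zero.mp ex.symm).resolve_left hN0
  · exact (mul_eq_zero.mp ey.symm).resolve_left hN0
  · exact (mul_eq_zero.mp ez.symm).resolve_left hN0
  · exact (mul_eq_zero.mp ew.symm).resolve_left hN0

theorem class19 {F : Type} [Field F] [NumberField F] (D : CubicData F 0 (-2) (-2)) (d : ℤ) (hd : Odd d)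
    (r t s : ℤ) (hrt : IsCoprime r t) (hrd : IsCoprime r d) (ht : t ≠ 0)
    (hs : s ^ 2 = r ^ 3 + (4 : ℤ) * d * r ^ 2 * t ^ 2 + (-144 : ℤ) * d ^ 2 * r * t ^ 4 + (-944 : ℤ) * d ^ 3 * t ^ 6) :
    ∃ e : F, (r : F) - d * t ^ 2 * D.el (-4) 6 2 = e ^ 2 := by
  have hd0 : d ≠ 0 := by rintro rfl; revert hd; decide
  have hrel := D.ie_rel
  push_cast at hrel
  have hT : D.ie (-4) 6 2 ^ 3 + ((4 : ℤ) : 𝓞 F) * D.ie (-4) 6 2 ^ 2 + ((-144 : ℤ) : 𝓞 F) * D.ie (-4) 6 2 + ((-944 : ℤ) : 𝓞 F) = 0 := by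
    rw [D.ie_eq (-4) 6 2]
    generalize D.ie 0 1 0 = th at hrel ⊢
    push_cast
    linear_combination ((184) * th ^ 0 + (200) * th ^ 1 + (72) * th ^ 2 + (8) * th ^ 3) * hrel
  have hgp : (3 * D.ie (-4) 6 2 ^ 2 + 2 * ((4 : ℤ) : 𝓞 F) * D.ie (-4) 6 2 + ((-144 : ℤ) : 𝓞 F)) * D.ie 1 1 0 =
      D.ie 0 1 0 ^ 8 * D.ie 1 (-1) 1 ^ 3 := by
    rw [D.ie_eq (-4) 6 2, D.ie_eq 1 1 0, D.ie_eq 1 (-1) 1]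
    generalize D.ie 0 1 0 = th at hrel ⊢
    push_cast
    linear_combination ((64) * th ^ 0 + (48) * th ^ 1 + (-38) * th ^ 2 + (-4) * th ^ 3 + (-14) * th ^ 4 + (-11) * th ^ 5 + (9) * th ^ 6 + (-16) * th ^ 7 + (11) * th ^ 8 + (-8) * th ^ 9 + (3) * th ^ 10 + (-1) * th ^ 11) * hrel
  have huu : D.ie 1 1 0 * D.ie (-1) (-1) 1 = 1 := by
    rw [D.ie_eq 1 1 0, D.ie_eq (-1) (-1) 1]
    generalize D.ie 0 1 0 = th at hrel ⊢
    push_cast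
    linear_combination (1) * hrel
  let u : (𝓞 F)ˣ := ⟨D.ie 1 1 0, D.ie (-1) (-1) 1, huu, (mul_comm _ _).trans huu⟩
  have hu1 : Algebra.norm ℤ (u : 𝓞 F) = 1 := by
    change Algebra.norm ℤ (D.ie 1 1 0) = 1
    rw [D.norm_ie]; norm_num
  have hform : ∀ x y z : ℚ, ∃ m : ℚ, D.el 1 1 0 * D.el x y z ^ 2 = D.el m (formA19 x y z) (formB19 x y z) := by
    intro x y z
    refine ⟨(x ^ 2 + 4 * y * z) + 2 * (2 * x * z + y ^ 2 + 2 * z ^ 2), ?_⟩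
    rw [sq, D.el_mul, D.el_mul]
    simp only [formA19, formB19]
    congr 1 <;> push_cast <;> ring
  have hcoe : ((u : 𝓞 F) : F) = D.el 1 1 0 := by
    change ((D.ie 1 1 0 : 𝓞 F) : F) = _
    rw [D.coe_ie]; norm_num
  have hns : ∀ v : (𝓞 F)ˣ, u ≠ v ^ 2 := by
    intro v hv
    have h1 : (u : 𝓞 F) * ((v⁻¹ : (𝓞 F)ˣ) : 𝓞 F) ^ 2 = 1 := by
      rw [hv, ← Units.val_pow_eq_pow_val, ← Units.val_mul, ← mul_pow, mul_inv_cancel]; simp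
    have h2 := congrArg (fun x : 𝓞 F => (x : F)) h1
    simp only [map_mul, map_pow, hcoe, map_one] at h2
    obtain ⟨x, y, z, hxyz⟩ := D.exists_el (algebraMap (𝓞 F) F ((v⁻¹ : (𝓞 F)ˣ) : 𝓞 F))
    rw [hxyz] at h2
    obtain ⟨m, hm⟩ := hform x y z
    rw [hm] at h2
    have h3 : (1 : F) = D.el 1 0 0 := by simp [CubicData.el]
    rw [h3] at h2
    obtain ⟨g0, g1, g2⟩ := D.el_inj h2
    obtain ⟨rfl, rfl, rfl, -⟩ := excl_rat19 1 odd_one x y z 0 (by rw [g1]; norm_num) (by rw [g2]; norm_num)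
    have h4 : (algebraMap (𝓞 F) F ((v⁻¹ : (𝓞 F)ˣ) : 𝓞 F)) = 0 := by rw [hxyz]; simp [CubicData.el]
    have h5 : ((v⁻¹ : (𝓞 F)ˣ) : 𝓞 F) = 0 := RingOfIntegers.ext (h4.trans (map_zero (algebraMap (𝓞 F) F)).symm)
    exact (v⁻¹).ne_zero h5
  have hel : (r : 𝓞 F) - d * t ^ 2 * D.ie (-4) 6 2 = D.ie (r - d * t ^ 2 * (-4)) (- d * t ^ 2 * (6)) (- d * t ^ 2 * (2)) := by
    rw [D.ie_eq (-4) 6 2, D.ie_eq (r - d * t ^ 2 * (-4))]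
    push_cast
    ring
  have hNs : Algebra.norm ℤ ((r : 𝓞 F) - d * t ^ 2 * D.ie (-4) 6 2) = s ^ 2 := by
    rw [hel, D.norm_ie, hs]; ring
  have hne : (r : 𝓞 F) - d * t ^ 2 * D.ie (-4) 6 2 ≠ 0 := by
    intro h0
    rw [hel] at h0
    have h1 := congrArg (fun x : 𝓞 F => (x : F)) h0
    simp only [D.coe_ie, map_zero] at h1
    have h3 : (0 : F) = D.el 0 0 0 := by simp [CubicData.el]
    rw [h3] at h1
    obtain ⟨-, g1, -⟩ := D.el_inj h1
    have g1 : (- d * t ^ 2 * (6)) = 0 := by exact_mod_cast g1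
    have : d * t ^ 2 ≠ 0 := mul_ne_zero hd0 (pow_ne_zero 2 ht)
    apply this
    linarith
  have n1 : Ideal.absNorm (Ideal.span {D.ie 0 1 0}) = 2 := D.absNorm_ie _ _ _ _ (by norm_num)
  have n2 : Ideal.absNorm (Ideal.span {D.ie 1 (-1) 1}) = 19 := D.absNorm_ie _ _ _ _ (by norm_num)
  have hT1 : ((D.ie (-4) 6 2 : 𝓞 F) : F) = D.el (-4) 6 2 := by rw [D.coe_ie]; norm_num
  have hTF : (((r : 𝓞 F) - d * t ^ 2 * D.ie (-4) 6 2 : 𝓞 F) : F) = (r : F) - d * t ^ 2 * D.el (-4) 6 2 := by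
    rw [← hT1]; simp only [map_sub, map_mul, map_pow, map_intCast]
  obtain ⟨e, he | he⟩ := D.square_class (by norm_num) (by norm_num) (by norm_num) (by norm_num) (by norm_num)
    (D.ie (-4) 6 2) (D.ie 0 1 0) (D.ie 1 (-1) 1) (D.ie 1 1 0) _ _ _ hT 2 19 (by norm_num) (by norm_num) (by norm_num)
    (D.prime_ie _ _ _ 2 (by norm_num) n1) (D.prime_ie _ _ _ 19 (by norm_num) n2)
    (by rw [← Ideal.absNorm_span_singleton, n1]) (by rw [← Ideal.absNorm_span_singleton, n2])
    8 3 hgp u hu1 hns d r t s hrt hrd hs hNs hne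
  · refine ⟨e, ?_⟩
    rw [← hTF, he]; simp
  · exfalso
    have h1 := congrArg (fun x : 𝓞 F => (x : F)) he
    simp only [map_mul, map_pow, hcoe] at h1
    rw [hTF] at h1
    obtain ⟨x, y, z, hxyz⟩ := D.exists_el (algebraMap (𝓞 F) F e)
    obtain ⟨m, hm⟩ := hform x y z
    rw [hxyz, hm] at h1
    have h2 : (r : F) - d * t ^ 2 * D.el (-4) 6 2 = D.el (r - d * t ^ 2 * (-4)) (- d * t ^ 2 * (6)) (- d * t ^ 2 * (2)) := by
      simp only [CubicData.el]; push_cast; ring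
    rw [h2] at h1
    obtain ⟨-, g1, g2⟩ := D.el_inj h1
    obtain ⟨-, -, -, h0⟩ := excl_rat19 d hd x y z t (by rw [← g1]; ring) (by rw [← g2]; ring)
    exact ht (by exact_mod_cast h0)

theorem halve19 (d : ℤ) (hd : Odd d) (hdp : d = 1 ∨ (Prime d ∧ ∀ r t : ℤ,
      d ∣ r ^ 3 + (4 : ℤ) * r ^ 2 * t + (-144 : ℤ) * r * t ^ 2 + (-944 : ℤ) * t ^ 3 → d ∣ t))
    (x v : ℚ) (h : d * v ^ 2 = G19 x) :
    ∃ m y : ℚ, d * y ^ 2 = G19 m ∧ x * G19 m = F19 m := by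
  have hd0 : d ≠ 0 := by rintro rfl; revert hd; decide
  have hdQ : (d : ℚ) ≠ 0 := by exact_mod_cast hd0
  obtain ⟨F, _, _, ⟨D⟩⟩ := exists_cubicData 0 (-2) (-2) (by norm_num) (by norm_num) (by norm_num) (by norm_num)
  have hrel := D.hθ
  push_cast at hrel
  obtain ⟨m, y, h1, h2⟩ := D.halve_generic (-4) 6 2 64 8 28 (4) (-144) (-944)
    (by
      simp only [CubicData.el]
      generalize D.θ = th at hrel ⊢
      push_cast
      linear_combination ((184) * th ^ 0 + (200) * th ^ 1 + (72) * th ^ 2 + (8) * th ^ 3) * hrel)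
    (by
      rw [sq, D.el_mul]
      congr 1 <;> norm_num) (by norm_num) d hd0 hdp
    (fun r t s hrt hrd ht hs => class19 D d hd r t s hrt hrd ht hs) (4 * d * x) (4 * d ^ 2 * v)
    (by
      simp only [G19] at h
      push_cast
      linear_combination 16 * d ^ 3 * h)
  push_cast at h1 h2
  have hm : m = 4 * d * (m / (4 * d)) := by field_simp
  have hy : y = 4 * d ^ 2 * (y / (4 * d ^ 2)) := by field_simp
  generalize m / (4 * d) = m' at hm
  generalize y / (4 * d ^ 2) = y' at hy
  have h3 : d * y' ^ 2 = G19 m' := by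
    simp only [G19]
    apply mul_left_cancel₀ (mul_ne_zero (by norm_num : (16 : ℚ) ≠ 0) (pow_ne_zero 3 hdQ))
    rw [hm, hy] at h1
    linear_combination h1
  refine ⟨m', y', h3, ?_⟩
  rw [← h3]
  simp only [F19]
  apply mul_left_cancel₀ (mul_ne_zero (by norm_num : (256 : ℚ) ≠ 0) (pow_ne_zero 4 hdQ))
  rw [hm, hy] at h2
  linear_combination h2

end

section
set_option autoImplicit false


theorem height11 (x m : ℚ) (hG : 0 ≤ G11 m) (h : x * G11 m = F11 m) (hx : 0 < x) :
    m.num ^ 4 ≤ 161051 * x.num ∧ 0 < m.num := by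
  have hm3 : 4 < m := by
    by_contra hc
    push Not at hc
    have : G11 m < 0 := by
      simp only [G11]
      nlinarith [mul_nonneg (sub_nonneg.2 hc) (sq_nonneg (m + 2))]
    linarith
  have hq : 0 < m.den := m.den_pos
  have hqx : 0 < x.den := x.den_pos
  have hcm := m.reduced
  have hcx := x.reduced
  have hP : 0 < m.num := Rat.num_pos.2 (by linarith)
  have hpx : 0 < x.num := Rat.num_pos.2 hx
  have em : m = m.num / m.den := (Rat.num_div_den m).symm
  have ex : x = x.num / x.den := (Rat.num_div_den x).symm
  refine ⟨?_, hP⟩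
  have hq' : (m.den : ℚ) ≠ 0 := by positivity
  have hqx' : (x.den : ℚ) ≠ 0 := by positivity
  generalize x.num = p at *
  generalize x.den = q at *
  generalize m.num = P at *
  generalize m.den = Q at *
  have key : p * (Q * ((-79) * P ^ 0 * Q ^ 3 + (-40) * P ^ 1 * Q ^ 2 + (-4) * P ^ 2 * Q ^ 1 + (4) * P ^ 3 * Q ^ 0)) = q * ((21) * P ^ 0 * Q ^ 4 + (158) * P ^ 1 * Q ^ 3 + (20) * P ^ 2 * Q ^ 2 + (1) * P ^ 4 * Q ^ 0) := by
    have : (p : ℚ) * (Q * ((-79) * P ^ 0 * Q ^ 3 + (-40) * P ^ 1 * Q ^ 2 + (-4) * P ^ 2 * Q ^ 1 + (4) * P ^ 3 * Q ^ 0)) = q * ((21) * P ^ 0 * Q ^ 4 + (158) * P ^ 1 * Q ^ 3 + (20) * P ^ 2 * Q ^ 2 + (1) * P ^ 4 * Q ^ 0) := by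
      rw [em, ex] at h
      simp only [G11, F11] at h
      field_simp at h
      linear_combination h
    exact_mod_cast this
  have hcop : IsCoprime p (q : ℤ) := Int.isCoprime_iff_nat_coprime.2 (by simpa using hcx)
  have hcop2 : IsCoprime P (Q : ℤ) := Int.isCoprime_iff_nat_coprime.2 (by simpa using hcm)
  obtain ⟨e, he⟩ : p ∣ (21) * P ^ 0 * Q ^ 4 + (158) * P ^ 1 * Q ^ 3 + (20) * P ^ 2 * Q ^ 2 + (1) * P ^ 4 * Q ^ 0 := hcop.dvd_of_dvd_mul_left ⟨_, key.symm⟩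
  have he2 : Q * ((-79) * P ^ 0 * Q ^ 3 + (-40) * P ^ 1 * Q ^ 2 + (-4) * P ^ 2 * Q ^ 1 + (4) * P ^ 3 * Q ^ 0) = q * e := by
    rw [he] at key
    apply mul_left_cancel₀ hpx.ne'
    linear_combination key
  have d1 : e ∣ 161051 * P ^ 7 :=
    ⟨p * ((-2759154) * P ^ 0 * Q ^ 3 + (-1278856) * P ^ 1 * Q ^ 2 + (-86500) * P ^ 2 * Q ^ 1 + (161051) * P ^ 3 * Q ^ 0) + q * ((-733446) * P ^ 0 * Q ^ 3 + (-5486892) * P ^ 1 * Q ^ 2 + (-463916) * P ^ 2 * Q ^ 1 + (21625) * P ^ 3 * Q ^ 0), by linear_combination ((-2759154) * P ^ 0 * Q ^ 3 + (-1278856) * P ^ 1 * Q ^ 2 + (-86500) * P ^ 2 * Q ^ 1 + (161051) * P ^ 3 * Q ^ 0) * he + ((-733446) * P ^ 0 * Q ^ 3 + (-5486892) * P ^ 1 * Q ^ 2 + (-463916) * P ^ 2 * Q ^ 1 + (21625) * P ^ 3 * Q ^ 0) * he2⟩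
  have d2 : e ∣ 161051 * Q ^ 7 :=
    ⟨p * ((-656) * P ^ 0 * Q ^ 3 + (-32) * P ^ 1 * Q ^ 2 + (48) * P ^ 2 * Q ^ 1) + q * ((-2213) * P ^ 0 * Q ^ 3 + (-200) * P ^ 1 * Q ^ 2 + (-4) * P ^ 2 * Q ^ 1 + (-12) * P ^ 3 * Q ^ 0), by linear_combination ((-656) * P ^ 0 * Q ^ 3 + (-32) * P ^ 1 * Q ^ 2 + (48) * P ^ 2 * Q ^ 1) * he + ((-2213) * P ^ 0 * Q ^ 3 + (-200) * P ^ 1 * Q ^ 2 + (-4) * P ^ 2 * Q ^ 1 + (-12) * P ^ 3 * Q ^ 0) * he2⟩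
  obtain ⟨a, b, hab⟩ := (hcop2.pow : IsCoprime (P ^ 7) ((Q : ℤ) ^ 7))
  have d3 : e ∣ 161051 := by
    have := (d1.mul_left a).add (d2.mul_left b)
    rwa [show a * (161051 * P ^ 7) + b * (161051 * Q ^ 7) = (161051 : ℤ) by linear_combination 161051 * hab] at this
  have hle := Int.le_of_dvd (by norm_num) d3
  have hQ : (0 : ℤ) < Q := by exact_mod_cast hq
  have : P ^ 4 ≤ p * e := by
    rw [← he]
    have h1 : 0 ≤ P ^ 2 * (Q : ℤ) ^ 2 := by positivity
    have h2 : 0 ≤ P * (Q : ℤ) ^ 3 := by positivity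
    have h3 : 0 ≤ (Q : ℤ) ^ 4 := by positivity
    linarith
  nlinarith

theorem check11 : ∀ d ∈ [1, 3, 5], ∀ p ∈ List.range 55, ∀ q ∈ List.range 14, 0 < q →
    Int.sqrt ((d : ℤ) * q * ((-79) * p ^ 0 * q ^ 3 + (-40) * p ^ 1 * q ^ 2 + (-4) * p ^ 2 * q ^ 1 + (4) * p ^ 3 * q ^ 0)) * Int.sqrt ((d : ℤ) * q * ((-79) * p ^ 0 * q ^ 3 + (-40) * p ^ 1 * q ^ 2 + (-4) * p ^ 2 * q ^ 1 + (4) * p ^ 3 * q ^ 0)) = (d : ℤ) * q * ((-79) * p ^ 0 * q ^ 3 + (-40) * p ^ 1 * q ^ 2 + (-4) * p ^ 2 * q ^ 1 + (4) * p ^ 3 * q ^ 0) →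
    p = 5 * q ∨ p = 16 * q := by
  decide +kernel

theorem solve11 (d : ℤ) (hd : d ∈ [1, 3, 5]) (hdp : d = 1 ∨ (Prime d ∧ ∀ r t : ℤ,
      d ∣ r ^ 3 + (-4 : ℤ) * r ^ 2 * t + (-160 : ℤ) * r * t ^ 2 + (-1264 : ℤ) * t ^ 3 → d ∣ t))
    (x v : ℚ) (h : d * v ^ 2 = G11 x) : x = 5 ∨ x = 16 := by
  have hodd : Odd d := by
    simp only [List.mem_cons, List.not_mem_nil, or_false] at hd
    rcases hd with rfl | rfl | rfl <;> decide
  have hdpos : (0 : ℚ) < d := by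
    simp only [List.mem_cons, List.not_mem_nil, or_false] at hd
    rcases hd with rfl | rfl | rfl <;> norm_num
  have hpos : ∀ x v : ℚ, d * v ^ 2 = G11 x → 4 < x := by
    intro x v h
    by_contra hc
    push Not at hc
    have h1 : G11 x < 0 := by
      simp only [G11]
      nlinarith [mul_nonneg (sub_nonneg.2 hc) (sq_nonneg (x + 2))]
    have : 0 ≤ d * v ^ 2 := by positivity
    linarith
  obtain ⟨n, hn⟩ : ∃ n : ℕ, x.num < n := ⟨x.num.natAbs + 1, by omega⟩
  induction n generalizing x v with
  | zero =>
    have := Rat.num_pos.2 ((show (0 : ℚ) < 4 by norm_num).trans (hpos x v h))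
    rw [Nat.cast_zero] at hn; omega
  | succ n ih =>
    have hx := hpos x v h
    have hp := Rat.num_pos.2 ((show (0 : ℚ) < 4 by norm_num).trans hx)
    by_cases hsmall : x.num < 55
    · have ex : x = x.num / x.den := (Rat.num_div_den x).symm
      have hq : 0 < x.den := x.den_pos
      obtain ⟨p, hpn⟩ : ∃ p : ℕ, x.num = p := ⟨x.num.toNat, by omega⟩
      have hq' : (x.den : ℚ) ≠ 0 := by positivity
      rw [hpn] at ex hsmall
      have hc1 : 4 * (x.den : ℤ) < p := by
        rw [ex, lt_div_iff₀ (by positivity)] at hx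
        exact_mod_cast hx
      have hsq : IsSquare ((d : ℤ) * x.den * ((-79) * (p : ℤ) ^ 0 * (x.den : ℤ) ^ 3 + (-40) * (p : ℤ) ^ 1 * (x.den : ℤ) ^ 2 + (-4) * (p : ℤ) ^ 2 * (x.den : ℤ) ^ 1 + (4) * (p : ℤ) ^ 3 * (x.den : ℤ) ^ 0)) := by
        rw [← Rat.isSquare_intCast_iff]
        refine ⟨d * v * x.den ^ 2, ?_⟩
        rw [ex] at h
        simp only [G11] at h
        field_simp at h
        push_cast at h ⊢
        linear_combination (-d * (x.den : ℚ)) * h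
      obtain ⟨s, hs⟩ := hsq
      have := check11 d hd p (by simp; omega) x.den (by simp; omega) hq
        (by rw [hs, Int.sqrt_eq, ← Int.natCast_mul, Int.natAbs_mul_self])
      rw [ex]
      rcases this with this | this
      · left; rw [this]; push_cast; field_simp
      · right; rw [this]; push_cast; field_simp
    · obtain ⟨m, y, h1, h2⟩ := halve11 d hodd hdp x v h
      obtain ⟨h3, h4⟩ := height11 x m (by rw [← h1]; positivity) h2 ((show (0 : ℚ) < 4 by norm_num).trans hx)
      have hlt : m.num < x.num := by
        by_contra hc
        push Not at hc hsmall
        have h5 : x.num ^ 4 ≤ m.num ^ 4 := by gcongr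
        have h6 : 55 ^ 3 ≤ x.num ^ 3 := by gcongr
        nlinarith
      rcases ih m y h1 (by push_cast at hn; omega) with rfl | rfl
      · right; norm_num [G11, F11] at h2; linarith
      · left; norm_num [G11, F11] at h2; linarith

theorem height19 (x m : ℚ) (hG : 0 ≤ G19 m) (h : x * G19 m = F19 m) (hx : 0 < x) :
    m.num ^ 4 ≤ 6859 * x.num ∧ 0 < m.num := by
  have hm3 : 3 < m := by
    by_contra hc
    push Not at hc
    have : G19 m < 0 := by
      simp only [G19]
      nlinarith [mul_nonneg (sub_nonneg.2 hc) (sq_nonneg (m + 2))]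
    linarith
  have hq : 0 < m.den := m.den_pos
  have hqx : 0 < x.den := x.den_pos
  have hcm := m.reduced
  have hcx := x.reduced
  have hP : 0 < m.num := Rat.num_pos.2 (by linarith)
  have hpx : 0 < x.num := Rat.num_pos.2 hx
  have em : m = m.num / m.den := (Rat.num_div_den m).symm
  have ex : x = x.num / x.den := (Rat.num_div_den x).symm
  refine ⟨?_, hP⟩
  have hq' : (m.den : ℚ) ≠ 0 := by positivity
  have hqx' : (x.den : ℚ) ≠ 0 := by positivity
  generalize x.num = p at *
  generalize x.den = q at *
  generalize m.num = P at *
  generalize m.den = Q at *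
  have key : p * (Q * ((-59) * P ^ 0 * Q ^ 3 + (-36) * P ^ 1 * Q ^ 2 + (4) * P ^ 2 * Q ^ 1 + (4) * P ^ 3 * Q ^ 0)) = q * ((140) * P ^ 0 * Q ^ 4 + (118) * P ^ 1 * Q ^ 3 + (18) * P ^ 2 * Q ^ 2 + (1) * P ^ 4 * Q ^ 0) := by
    have : (p : ℚ) * (Q * ((-59) * P ^ 0 * Q ^ 3 + (-36) * P ^ 1 * Q ^ 2 + (4) * P ^ 2 * Q ^ 1 + (4) * P ^ 3 * Q ^ 0)) = q * ((140) * P ^ 0 * Q ^ 4 + (118) * P ^ 1 * Q ^ 3 + (18) * P ^ 2 * Q ^ 2 + (1) * P ^ 4 * Q ^ 0) := by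
      rw [em, ex] at h
      simp only [G19, F19] at h
      field_simp at h
      linear_combination h
    exact_mod_cast this
  have hcop : IsCoprime p (q : ℤ) := Int.isCoprime_iff_nat_coprime.2 (by simpa using hcx)
  have hcop2 : IsCoprime P (Q : ℤ) := Int.isCoprime_iff_nat_coprime.2 (by simpa using hcm)
  obtain ⟨e, he⟩ : p ∣ (140) * P ^ 0 * Q ^ 4 + (118) * P ^ 1 * Q ^ 3 + (18) * P ^ 2 * Q ^ 2 + (1) * P ^ 4 * Q ^ 0 := hcop.dvd_of_dvd_mul_left ⟨_, key.symm⟩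
  have he2 : Q * ((-59) * P ^ 0 * Q ^ 3 + (-36) * P ^ 1 * Q ^ 2 + (4) * P ^ 2 * Q ^ 1 + (4) * P ^ 3 * Q ^ 0) = q * e := by
    rw [he] at key
    apply mul_left_cancel₀ hpx.ne'
    linear_combination key
  have d1 : e ∣ 6859 * P ^ 7 :=
    ⟨p * ((-340194) * P ^ 0 * Q ^ 3 + (-111878) * P ^ 1 * Q ^ 2 + (48416) * P ^ 2 * Q ^ 1 + (6859) * P ^ 3 * Q ^ 0) + q * ((-807240) * P ^ 0 * Q ^ 3 + (-453308) * P ^ 1 * Q ^ 2 + (9208) * P ^ 2 * Q ^ 1 + (-12104) * P ^ 3 * Q ^ 0), by linear_combination ((-340194) * P ^ 0 * Q ^ 3 + (-111878) * P ^ 1 * Q ^ 2 + (48416) * P ^ 2 * Q ^ 1 + (6859) * P ^ 3 * Q ^ 0) * he + ((-807240) * P ^ 0 * Q ^ 3 + (-453308) * P ^ 1 * Q ^ 2 + (9208) * P ^ 2 * Q ^ 1 + (-12104) * P ^ 3 * Q ^ 0) * he2⟩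
  have d2 : e ∣ 6859 * Q ^ 7 :=
    ⟨p * ((-592) * P ^ 0 * Q ^ 3 + (32) * P ^ 1 * Q ^ 2 + (48) * P ^ 2 * Q ^ 1) + q * ((-1521) * P ^ 0 * Q ^ 3 + (-180) * P ^ 1 * Q ^ 2 + (4) * P ^ 2 * Q ^ 1 + (-12) * P ^ 3 * Q ^ 0), by linear_combination ((-592) * P ^ 0 * Q ^ 3 + (32) * P ^ 1 * Q ^ 2 + (48) * P ^ 2 * Q ^ 1) * he + ((-1521) * P ^ 0 * Q ^ 3 + (-180) * P ^ 1 * Q ^ 2 + (4) * P ^ 2 * Q ^ 1 + (-12) * P ^ 3 * Q ^ 0) * he2⟩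
  obtain ⟨a, b, hab⟩ := (hcop2.pow : IsCoprime (P ^ 7) ((Q : ℤ) ^ 7))
  have d3 : e ∣ 6859 := by
    have := (d1.mul_left a).add (d2.mul_left b)
    rwa [show a * (6859 * P ^ 7) + b * (6859 * Q ^ 7) = (6859 : ℤ) by linear_combination 6859 * hab] at this
  have hle := Int.le_of_dvd (by norm_num) d3
  have hQ : (0 : ℤ) < Q := by exact_mod_cast hq
  have : P ^ 4 ≤ p * e := by
    rw [← he]
    have h1 : 0 ≤ P ^ 2 * (Q : ℤ) ^ 2 := by positivity
    have h2 : 0 ≤ P * (Q : ℤ) ^ 3 := by positivity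
    have h3 : 0 ≤ (Q : ℤ) ^ 4 := by positivity
    linarith
  nlinarith

theorem check19 : ∀ d ∈ [1, 5, 7], ∀ p ∈ List.range 20, ∀ q ∈ List.range 7, 0 < q →
    Int.sqrt ((d : ℤ) * q * ((-59) * p ^ 0 * q ^ 3 + (-36) * p ^ 1 * q ^ 2 + (4) * p ^ 2 * q ^ 1 + (4) * p ^ 3 * q ^ 0)) * Int.sqrt ((d : ℤ) * q * ((-59) * p ^ 0 * q ^ 3 + (-36) * p ^ 1 * q ^ 2 + (4) * p ^ 2 * q ^ 1 + (4) * p ^ 3 * q ^ 0)) = (d : ℤ) * q * ((-59) * p ^ 0 * q ^ 3 + (-36) * p ^ 1 * q ^ 2 + (4) * p ^ 2 * q ^ 1 + (4) * p ^ 3 * q ^ 0) →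
    p = 5 * q := by
  decide +kernel

theorem solve19 (d : ℤ) (hd : d ∈ [1, 5, 7]) (hdp : d = 1 ∨ (Prime d ∧ ∀ r t : ℤ,
      d ∣ r ^ 3 + (4 : ℤ) * r ^ 2 * t + (-144 : ℤ) * r * t ^ 2 + (-944 : ℤ) * t ^ 3 → d ∣ t))
    (x v : ℚ) (h : d * v ^ 2 = G19 x) : x = 5 := by
  have hodd : Odd d := by
    simp only [List.mem_cons, List.not_mem_nil, or_false] at hd
    rcases hd with rfl | rfl | rfl <;> decide
  have hdpos : (0 : ℚ) < d := by
    simp only [List.mem_cons, List.not_mem_nil, or_false] at hd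
    rcases hd with rfl | rfl | rfl <;> norm_num
  have hpos : ∀ x v : ℚ, d * v ^ 2 = G19 x → 3 < x := by
    intro x v h
    by_contra hc
    push Not at hc
    have h1 : G19 x < 0 := by
      simp only [G19]
      nlinarith [mul_nonneg (sub_nonneg.2 hc) (sq_nonneg (x + 2))]
    have : 0 ≤ d * v ^ 2 := by positivity
    linarith
  obtain ⟨n, hn⟩ : ∃ n : ℕ, x.num < n := ⟨x.num.natAbs + 1, by omega⟩
  induction n generalizing x v with
  | zero =>
    have := Rat.num_pos.2 ((show (0 : ℚ) < 3 by norm_num).trans (hpos x v h))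
    rw [Nat.cast_zero] at hn; omega
  | succ n ih =>
    have hx := hpos x v h
    have hp := Rat.num_pos.2 ((show (0 : ℚ) < 3 by norm_num).trans hx)
    by_cases hsmall : x.num < 20
    · have ex : x = x.num / x.den := (Rat.num_div_den x).symm
      have hq : 0 < x.den := x.den_pos
      obtain ⟨p, hpn⟩ : ∃ p : ℕ, x.num = p := ⟨x.num.toNat, by omega⟩
      have hq' : (x.den : ℚ) ≠ 0 := by positivity
      rw [hpn] at ex hsmall
      have hc1 : 3 * (x.den : ℤ) < p := by
        rw [ex, lt_div_iff₀ (by positivity)] at hx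
        exact_mod_cast hx
      have hsq : IsSquare ((d : ℤ) * x.den * ((-59) * (p : ℤ) ^ 0 * (x.den : ℤ) ^ 3 + (-36) * (p : ℤ) ^ 1 * (x.den : ℤ) ^ 2 + (4) * (p : ℤ) ^ 2 * (x.den : ℤ) ^ 1 + (4) * (p : ℤ) ^ 3 * (x.den : ℤ) ^ 0)) := by
        rw [← Rat.isSquare_intCast_iff]
        refine ⟨d * v * x.den ^ 2, ?_⟩
        rw [ex] at h
        simp only [G19] at h
        field_simp at h
        push_cast at h ⊢
        linear_combination (-d * (x.den : ℚ)) * h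
      obtain ⟨s, hs⟩ := hsq
      have := check19 d hd p (by simp; omega) x.den (by simp; omega) hq
        (by rw [hs, Int.sqrt_eq, ← Int.natCast_mul, Int.natAbs_mul_self])
      rw [ex, this]; push_cast; field_simp
    · obtain ⟨m, y, h1, h2⟩ := halve19 d hodd hdp x v h
      obtain ⟨h3, h4⟩ := height19 x m (by rw [← h1]; positivity) h2 ((show (0 : ℚ) < 3 by norm_num).trans hx)
      have hlt : m.num < x.num := by
        by_contra hc
        push Not at hc hsmall
        have h5 : x.num ^ 4 ≤ m.num ^ 4 := by gcongr
        have h6 : 20 ^ 3 ≤ x.num ^ 3 := by gcongr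
        nlinarith
      have := ih m y h1 (by push_cast at hn; omega)
      subst this
      norm_num [G19, F19] at h2; linarith

theorem hdp_of (n : ℕ) [hn : Fact n.Prime] (al be ga : ℤ)
    (h : ∀ r t : ZMod n, r ^ 3 + al * r ^ 2 * t + be * r * t ^ 2 + ga * t ^ 3 = 0 → t = 0) :
    Prime (n : ℤ) ∧ ∀ r t : ℤ, (n : ℤ) ∣ r ^ 3 + al * r ^ 2 * t + be * r * t ^ 2 + ga * t ^ 3 → (n : ℤ) ∣ t := by
  refine ⟨Nat.prime_iff_prime_int.1 hn.1, fun r t hd => ?_⟩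
  rw [← ZMod.intCast_zmod_eq_zero_iff_dvd] at hd ⊢
  push_cast at hd
  exact h _ _ hd

instance fact_prime_five_aux : Fact (Nat.Prime 5) := ⟨by norm_num⟩

instance fact_prime_seven_aux : Fact (Nat.Prime 7) := ⟨by norm_num⟩

theorem final11_1 (x v : ℚ) (h : v ^ 2 = G11 x) : x = 5 ∨ x = 16 :=
  solve11 1 (by simp) (Or.inl rfl) x v (by rw [← h]; push_cast; ring)

theorem final19_1 (x v : ℚ) (h : v ^ 2 = G19 x) : x = 5 :=
  solve19 1 (by simp) (Or.inl rfl) x v (by rw [← h]; push_cast; ring)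

theorem not_mul_sq (d n : ℤ) (hn : ¬ IsSquare (d * n)) (v : ℚ) : (d : ℚ) * v ^ 2 ≠ n := by
  intro h
  apply hn
  rw [← Rat.isSquare_intCast_iff]
  refine ⟨d * v, ?_⟩
  push_cast
  linear_combination (-(d : ℚ)) * h

theorem nonsq (d : ℤ) (h : Int.sqrt d * Int.sqrt d ≠ d) : ¬ IsSquare d := by
  rintro ⟨s, hs⟩
  apply h
  rw [hs, Int.sqrt_eq, ← Int.natCast_mul, Int.natAbs_mul_self]

theorem final11 (d : ℤ) (hd : d = 3 ∨ d = 5) (x v : ℚ) (h : d * v ^ 2 = G11 x) : False := by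
  have h1 : x = 5 ∨ x = 16 := by
    rcases hd with rfl | rfl
    · exact solve11 3 (by simp) (Or.inr (hdp_of 3 _ _ _ (by decide +kernel))) x v h
    · exact solve11 5 (by simp) (Or.inr (hdp_of 5 _ _ _ (by decide +kernel))) x v h
  rcases h1 with rfl | rfl
  · refine not_mul_sq d 121 ?_ v (by rw [h]; norm_num [G11])
    rcases hd with rfl | rfl <;> exact nonsq _ (by decide +kernel)
  · refine not_mul_sq d 14641 ?_ v (by rw [h]; norm_num [G11])
    rcases hd with rfl | rfl <;> exact nonsq _ (by decide +kernel)

theorem final19 (d : ℤ) (hd : d = 5 ∨ d = 7) (x v : ℚ) (h : d * v ^ 2 = G19 x) : False := by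
  have h1 : x = 5 := by
    rcases hd with rfl | rfl
    · exact solve19 5 (by simp) (Or.inr (hdp_of 5 _ _ _ (by decide +kernel))) x v h
    · exact solve19 7 (by simp) (Or.inr (hdp_of 7 _ _ _ (by decide +kernel))) x v h
  subst h1
  refine not_mul_sq d 361 ?_ v (by rw [h]; norm_num [G19])
  rcases hd with rfl | rfl <;> exact nonsq _ (by decide +kernel)

end

section
set_option autoImplicit false

theorem sq_left {a b c : ℤ} (ha : 0 < a) (hab : IsCoprime a b) (h : a * b = c ^ 2) :
    ∃ x : ℤ, 0 < x ∧ a = x ^ 2 := by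
  obtain ⟨x, hx | hx⟩ := Int.sq_of_isCoprime hab h
  · refine ⟨|x|, ?_, by rw [sq_abs, hx]⟩
    rw [abs_pos]; rintro rfl; simp at hx; omega
  · nlinarith [sq_nonneg x]

theorem sq_both {a b c : ℤ} (ha : 0 < a) (hb : 0 < b) (hab : IsCoprime a b) (h : a * b = c ^ 2) :
    ∃ x y : ℤ, 0 < x ∧ 0 < y ∧ a = x ^ 2 ∧ b = y ^ 2 := by
  obtain ⟨x, hx⟩ := sq_left ha hab h
  obtain ⟨y, hy⟩ := sq_left hb hab.symm (by rw [mul_comm]; exact h)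
  exact ⟨x, y, hx.1, hy.1, hx.2, hy.2⟩

theorem sq_or_two_sq (k : ℕ) : ∀ {a b c : ℤ}, 0 < a → 0 < b →
    (∀ l : ℤ, l ∣ a → l ∣ b → l ∣ 2 ^ k) → a * b = c ^ 2 →
    (∃ x y : ℤ, 0 < x ∧ 0 < y ∧ a = x ^ 2 ∧ b = y ^ 2) ∨
    (∃ x y : ℤ, 0 < x ∧ 0 < y ∧ a = 2 * x ^ 2 ∧ b = 2 * y ^ 2) := by
  induction k with
  | zero =>
    intro a b c ha hb hl h
    left
    refine sq_both ha hb (isCoprime_of_prime_dvd (by omega) fun z hz h1 h2 => ?_) h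
    exact hz.not_isUnit (isUnit_of_dvd_one (by simpa using hl z h1 h2))
  | succ k ih =>
    intro a b c ha hb hl h
    by_cases h2 : (2 : ℤ) ∣ a ∧ (2 : ℤ) ∣ b
    · obtain ⟨⟨a', rfl⟩, ⟨b', rfl⟩⟩ := h2
      have hc : (2 : ℤ) ∣ c := by
        apply Int.prime_two.dvd_of_dvd_pow (n := 2)
        exact ⟨a' * (2 * b'), by rw [← h]; ring⟩
      obtain ⟨c', rfl⟩ := hc
      rcases ih (a := a') (b := b') (c := c') (by omega) (by omega) (fun l h1 h2 => by
        have := hl (2 * l) (mul_dvd_mul_left 2 h1) (mul_dvd_mul_left 2 h2)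
        rw [pow_succ'] at this
        exact Int.dvd_of_mul_dvd_mul_left (by norm_num) this) (by linarith) with ⟨x, y, h1, h2, h3, h4⟩ | ⟨x, y, h1, h2, h3, h4⟩
      · exact Or.inr ⟨x, y, h1, h2, by rw [h3], by rw [h4]⟩
      · exact Or.inl ⟨2 * x, 2 * y, by omega, by omega, by rw [h3]; ring, by rw [h4]; ring⟩
    · left
      refine sq_both ha hb (isCoprime_of_prime_dvd (by omega) fun z hz h1 h3 => ?_) h
      have h4 := hz.dvd_of_dvd_pow (hl z h1 h3)
      have h5 : Associated z 2 := hz.associated_of_dvd Int.prime_two h4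
      exact h2 ⟨h5.dvd_iff_dvd_left.1 h1, h5.dvd_iff_dvd_left.1 h3⟩

theorem two_sq_cases (k : ℕ) {a b c : ℤ} (ha : 0 < a) (hb : 0 < b)
    (hl : ∀ l : ℤ, l ∣ a → l ∣ b → l ∣ 2 ^ k) (h : 2 * a * b = c ^ 2) :
    (∃ x y : ℤ, 0 < x ∧ 0 < y ∧ a = 2 * x ^ 2 ∧ b = y ^ 2) ∨
    (∃ x y : ℤ, 0 < x ∧ 0 < y ∧ a = x ^ 2 ∧ b = 2 * y ^ 2) := by
  rcases sq_or_two_sq (k + 1) (a := 2 * a) (b := b) (c := c) (by omega) hb (fun l h1 h2 => by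
    have h3 : l ∣ 2 * b := h2.mul_left 2
    have h4 : l ∣ ((gcd (2 * a) (2 * b) : ℤ)) := dvd_gcd h1 h3
    rw [gcd_mul_left, pow_succ'] at *
    refine h4.trans (mul_dvd_mul (by simp) (hl _ (gcd_dvd_left _ _) (gcd_dvd_right _ _)))) h with ⟨x, y, h1, h2, h3, h4⟩ | ⟨x, y, h1, h2, h3, h4⟩
  · obtain ⟨x', rfl⟩ : (2 : ℤ) ∣ x := Int.prime_two.dvd_of_dvd_pow ⟨a, h3.symm⟩
    exact Or.inl ⟨x', y, by omega, h2, by linarith, h4⟩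
  · exact Or.inr ⟨x, y, h1, h2, by linarith, h4⟩



end

section
set_option autoImplicit false

theorem two_dvd_of_sq {a : ℤ} (b : ℤ) (h : a ^ 2 = 2 * b) : ∃ c, a = 2 * c :=
  Int.prime_two.dvd_of_dvd_pow (n := 2) ⟨b, h⟩

theorem odd_of_sq {a : ℤ} (b : ℤ) (h : a ^ 2 = 2 * b + 1) : ∃ c, a = 2 * c + 1 := by
  rcases Int.even_or_odd a with ⟨c, rfl⟩ | h
  · ring_nf at h; omega
  · exact h

theorem case_one {A B C D : ℤ} (hA : A % 2 = 1) (h1 : 2 * B ^ 2 + A ^ 2 = C ^ 2)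
    (h2 : 2 * B ^ 2 - 16 * A ^ 2 = 2 * D ^ 2) : False := by
  obtain ⟨a, rfl⟩ : ∃ a, A = 2 * a + 1 := ⟨A / 2, by omega⟩
  obtain ⟨c, rfl⟩ := odd_of_sq (a := C) (B ^ 2 + 2 * a ^ 2 + 2 * a) (by linarith)
  obtain ⟨b, rfl⟩ := two_dvd_of_sq (a := B) (c ^ 2 + c - a ^ 2 - a) (by linarith)
  obtain ⟨e, rfl⟩ := two_dvd_of_sq (a := D) (2 * b ^ 2 - 4 * (2 * a + 1) ^ 2) (by linarith)
  have h3 : e ^ 2 = b ^ 2 - 2 * (2 * a + 1) ^ 2 := by linarith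
  have h4 := congrArg (Int.cast : ℤ → ZMod 8) h3
  push_cast at h4
  generalize (e : ZMod 8) = e, (b : ZMod 8) = b, (a : ZMod 8) = a at h4
  revert h4; clear * -; revert e b a; decide +kernel

theorem case_i {A B C D : ℤ} (hA : A % 2 = 1) (hApos : 0 < A) (hB : 0 < B) (hC : 0 < C) (hD : 0 < D)
    (hBe : B % 2 = 0) (hcop : IsCoprime A B) (h1 : A ^ 2 + B ^ 2 = C ^ 2)
    (h2 : B ^ 2 - 16 * A ^ 2 = 2 * D ^ 2) : False := by
  obtain ⟨b, rfl⟩ : ∃ b, B = 2 * b := ⟨B / 2, by omega⟩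
  obtain ⟨e, rfl⟩ := two_dvd_of_sq (a := D) (b ^ 2 - 4 * A ^ 2) (by linarith)
  obtain ⟨b, rfl⟩ := two_dvd_of_sq (a := b) (e ^ 2 + 2 * A ^ 2) (by linarith)
  obtain ⟨e, rfl⟩ := two_dvd_of_sq (a := e) (b ^ 2 - A ^ 2) (by linarith)
  have h3 : b ^ 2 - A ^ 2 = 2 * e ^ 2 := by linarith
  have hcb : IsCoprime A b := (hcop.of_mul_right_right).of_mul_right_right
  obtain ⟨a, ha⟩ : ∃ a, A = 2 * a + 1 := ⟨A / 2, by omega⟩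
  obtain ⟨β, hβ⟩ := odd_of_sq (a := b) (e ^ 2 + 2 * a ^ 2 + 2 * a) (by rw [ha] at h3; linarith)
  -- first: A is ±3 mod 8
  obtain ⟨m, n, k1, k2, -, -, k3, -⟩ := PythagoreanTriple.coprime_classification' (x := A) (y := 2 * (2 * b)) (z := C)
    (by rw [PythagoreanTriple]; linarith) (Int.isCoprime_iff_gcd_eq_one.1 hcop) hA hC
  have m1 : (A : ZMod 8) = 3 ∨ (A : ZMod 8) = 5 := by
    have k4 : m * n = 2 * b := by linarith
    rcases k3 with ⟨k5, k6⟩ | ⟨k5, k6⟩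
    · obtain ⟨m, rfl⟩ : ∃ b, m = 2 * b := ⟨m / 2, by omega⟩
      have k6 : m * n = 2 * β + 1 := by linarith
      have k7 := congrArg (Int.cast : ℤ → ZMod 8) k6
      rw [k1]
      push_cast at k7 ⊢
      generalize (m : ZMod 8) = m, (n : ZMod 8) = n, (β : ZMod 8) = β at *
      revert k7; clear * -; revert m n β; decide +kernel
    · obtain ⟨n, rfl⟩ : ∃ b, n = 2 * b := ⟨n / 2, by omega⟩
      have k6 : m * n = 2 * β + 1 := by linarith
      have k7 := congrArg (Int.cast : ℤ → ZMod 8) k6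
      rw [k1]
      push_cast at k7 ⊢
      generalize (m : ZMod 8) = m, (n : ZMod 8) = n, (β : ZMod 8) = β at *
      revert k7; clear * -; revert m n β; decide +kernel
  -- second: A is ±1 mod 8
  obtain ⟨u, hu⟩ : ∃ u, b + A = 2 * u := ⟨β + a + 1, by rw [hβ, ha]; ring⟩
  obtain ⟨v, hv⟩ : ∃ u, b - A = 2 * u := ⟨β - a, by rw [hβ, ha]; ring⟩
  have huv : 2 * u * v = e ^ 2 := by
    have : (b + A) * (b - A) = 2 * e ^ 2 := by linarith
    rw [hu, hv] at this; linarith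
  have hb0 : 0 < b := by omega
  have hbA : 0 < b - A := by nlinarith [sq_pos_of_pos (show 0 < e by omega)]
  have hcuv : ∀ l : ℤ, l ∣ u → l ∣ v → l ∣ 2 ^ 0 := by
    intro l l1 l2
    have l3 : l ∣ b := by rw [show b = u + v by linarith]; exact l1.add l2
    have l4 : l ∣ A := by rw [show A = u - v by linarith]; exact l1.sub l2
    rw [pow_zero]
    exact isUnit_iff_dvd_one.1 (hcb.isUnit_of_dvd' l4 l3)
  have m2 : (A : ZMod 8) = 1 ∨ (A : ZMod 8) = 7 := by
    rcases two_sq_cases 0 (by omega) (by omega) hcuv huv with ⟨x, y, -, -, p1, p2⟩ | ⟨x, y, -, -, p1, p2⟩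
    · have q1 : A = 2 * x ^ 2 - y ^ 2 := by linarith
      have q2 : 2 * β + 1 = 2 * x ^ 2 + y ^ 2 := by linarith
      have k7 := congrArg (Int.cast : ℤ → ZMod 8) q2
      rw [q1]
      push_cast at k7 ⊢
      generalize (x : ZMod 8) = m, (y : ZMod 8) = n, (β : ZMod 8) = β at *
      revert k7; clear * -; revert m n β; decide +kernel
    · have q1 : A = x ^ 2 - 2 * y ^ 2 := by linarith
      have q2 : 2 * β + 1 = x ^ 2 + 2 * y ^ 2 := by linarith
      have k7 := congrArg (Int.cast : ℤ → ZMod 8) q2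
      rw [q1]
      push_cast at k7 ⊢
      generalize (x : ZMod 8) = m, (y : ZMod 8) = n, (β : ZMod 8) = β at *
      revert k7; clear * -; revert m n β; decide +kernel
  revert m1 m2
  generalize (A : ZMod 8) = t
  revert t; clear * -; decide

theorem case_iv {A B C D : ℤ} (hA : A % 2 = 1) (hB0 : B % 2 = 1) (hApos : 0 < A) (hB : 0 < B) (hC : 0 < C) (hD : 0 < D)
    (hcop : IsCoprime A B) (h1 : A ^ 2 + B ^ 2 = 2 * C ^ 2)
    (h2 : B ^ 2 - 16 * A ^ 2 = D ^ 2) : False := by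
  obtain ⟨a, ha⟩ : ∃ a, A = 2 * a + 1 := ⟨A / 2, by omega⟩
  obtain ⟨b, hb⟩ : ∃ b, B = 2 * b + 1 := ⟨B / 2, by omega⟩
  obtain ⟨e, he⟩ := odd_of_sq (a := D) (2 * b ^ 2 + 2 * b - 8 * A ^ 2) (by rw [← h2, hb]; ring)
  -- B is 5 mod 8
  have m1 : (B : ZMod 8) = 5 := by
    obtain ⟨u, hu⟩ : ∃ u, B + D = 2 * u := ⟨b + e + 1, by rw [hb, he]; ring⟩
    obtain ⟨v, hv⟩ : ∃ u, B - D = 2 * u := ⟨b - e, by rw [hb, he]; ring⟩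
    have huv : u * v = (2 * A) ^ 2 := by
      have : (B + D) * (B - D) = 16 * A ^ 2 := by linarith
      rw [hu, hv] at this; linarith
    have hBD : 0 < B - D := by nlinarith [sq_pos_of_pos hApos]
    have hcuv : IsCoprime u v := by
      refine isCoprime_of_prime_dvd (by omega) fun z hz h1 h3 => ?_
      have l3 : z ∣ B := by rw [show B = u + v by linarith]; exact h1.add h3
      have l4 : z ∣ 2 * A := hz.dvd_of_dvd_pow (huv ▸ h1.mul_right v)
      rcases hz.dvd_or_dvd l4 with l5 | l5
      · have h5 : Associated z 2 := hz.associated_of_dvd Int.prime_two l5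
        have := h5.dvd_iff_dvd_left.1 l3
        omega
      · exact hz.not_isUnit (hcop.isUnit_of_dvd' l5 l3)
    obtain ⟨x, y, -, -, p1, p2⟩ := sq_both (by omega) (by omega) hcuv huv
    have q1 : B = x ^ 2 + y ^ 2 := by linarith
    have q3 : (x * y - 2 * A) * (x * y + 2 * A) = 0 := by rw [p1, p2] at huv; linarith
    have q4 : ∃ A' : ℤ, x * y = 4 * A' + 2 := by
      rcases mul_eq_zero.1 q3 with q | q
      · exact ⟨a, by linarith⟩
      · exact ⟨-a - 1, by linarith⟩
    obtain ⟨A', q4⟩ := q4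
    have k7 := congrArg (Int.cast : ℤ → ZMod 8) q4
    have k8 := congrArg (Int.cast : ℤ → ZMod 8) hb
    rw [q1] at k8 ⊢
    push_cast at k7 k8 ⊢
    generalize (x : ZMod 8) = m, (y : ZMod 8) = n, (A' : ZMod 8) = β, (b : ZMod 8) = b at *
    revert k7 k8; clear * -
    have : ∀ m n : ZMod 8, (∃ β : ZMod 8, m * n = 4 * β + 2) → (∃ b, m ^ 2 + n ^ 2 = 2 * b + 1) → m ^ 2 + n ^ 2 = 5 := by
      decide +kernel
    exact fun h1 h2 => this m n ⟨_, h1⟩ ⟨_, h2⟩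
  have m2 : (B : ZMod 8) = 1 ∨ (B : ZMod 8) = 7 := by
    obtain ⟨u, hu⟩ : ∃ u, B + A = 2 * u := ⟨b + a + 1, by rw [hb, ha]; ring⟩
    obtain ⟨v, hv⟩ : ∃ u, B - A = 2 * u := ⟨b - a, by rw [hb, ha]; ring⟩
    have huv : u ^ 2 + v ^ 2 = C ^ 2 := by
      have : (B + A) ^ 2 + (B - A) ^ 2 = 4 * C ^ 2 := by linarith
      rw [hu, hv] at this; linarith
    have hcuv : IsCoprime u v := by
      refine isCoprime_of_prime_dvd (by omega) fun z hz h1 h3 => ?_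
      have l3 : z ∣ B := by rw [show B = u + v by linarith]; exact h1.add h3
      have l4 : z ∣ A := by rw [show A = u - v by linarith]; exact h1.sub h3
      exact hz.not_isUnit (hcop.isUnit_of_dvd' l4 l3)
    have main : ∀ u v : ℤ, u ^ 2 + v ^ 2 = C ^ 2 → IsCoprime u v → u % 2 = 1 → B = u + v →
        (B : ZMod 8) = 1 ∨ (B : ZMod 8) = 7 := by
      intro u v g1 g2 g3 g4
      obtain ⟨m, n, k1, k2, -, -, k3, -⟩ := PythagoreanTriple.coprime_classification' (x := u) (y := v) (z := C)
        (by rw [PythagoreanTriple]; linarith) (Int.isCoprime_iff_gcd_eq_one.1 g2) g3 hC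
      obtain ⟨c, hc⟩ : ∃ c, m + n = 2 * c + 1 := ⟨(m + n) / 2, by omega⟩
      have : B = (2 * c + 1) ^ 2 - 2 * n ^ 2 := by rw [← hc, g4, k1, k2]; ring
      rw [this]
      push_cast
      generalize (c : ZMod 8) = m, (n : ZMod 8) = n
      clear * -; revert m n; decide +kernel
    rcases Int.emod_two_eq_zero_or_one u with hu2 | hu2
    · exact main v u (by linarith) hcuv.symm (by omega) (by linarith)
    · exact main u v huv hcuv hu2 (by linarith)
  rw [m1] at m2
  revert m2; decide


end

section
set_option autoImplicit false

theorem case_ii_core {x y e f t A : ℤ} (h1 : y ^ 2 - 17 * x ^ 2 = 8 * e) (h2 : A ^ 2 + e ^ 2 = 2 * f ^ 2)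
    (hA : A ^ 2 = x ^ 2 * y ^ 2) (hAo : A % 2 = 1) (hc : IsCoprime y (17 * x)) (ht : y = x + 4 * t) : False := by
  obtain ⟨a, ha⟩ : ∃ a, A = 2 * a + 1 := ⟨A / 2, by omega⟩
  obtain ⟨E, hE⟩ := odd_of_sq (a := e) (f ^ 2 - 2 * a ^ 2 - 2 * a - 1) (by rw [ha] at h2; linarith)
  have hx : ∃ X, x = 2 * X + 1 := by
    rcases Int.even_or_odd' x with ⟨X, hX | hX⟩
    · have h5 : A ^ 2 = 2 * (2 * X ^ 2 * y ^ 2) := by rw [hA, hX]; ring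
      obtain ⟨c, hc⟩ := two_dvd_of_sq _ h5
      omega
    · exact ⟨X, hX⟩
  obtain ⟨X, hX⟩ := hx
  have key : ((2 * t + x) ^ 2 + 4 * x ^ 2) * (2 * (t ^ 2 + x ^ 2)) = (2 * f) ^ 2 := by
    have h3 : 64 * (x ^ 2 * y ^ 2) + (y ^ 2 - 17 * x ^ 2) ^ 2 = 128 * f ^ 2 := by
      rw [← hA, h1]; linarith
    rw [ht] at h3
    linarith
  have hx0 : x ≠ 0 := by omega
  have hxp : 0 < x ^ 2 := by positivity
  have hcop : IsCoprime ((2 * t + x) ^ 2 + 4 * x ^ 2) (2 * (t ^ 2 + x ^ 2)) := by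
    refine isCoprime_of_prime_dvd (fun h => ?_) fun z hz g1 g2 => ?_
    · nlinarith [h.1, sq_nonneg (2 * t + x)]
    · have hz2 : ¬ z ∣ 2 := by
        intro h4
        have h5 : Associated z 2 := hz.associated_of_dvd Int.prime_two h4
        obtain ⟨w, hw⟩ := h5.dvd_iff_dvd_left.1 g1
        rw [hX] at hw
        ring_nf at hw
        omega
      have g3 : z ∣ t ^ 2 + x ^ 2 := (hz.dvd_or_dvd g2).resolve_left hz2
      have g4 : z ∣ x * y := by
        have : x * y = ((2 * t + x) ^ 2 + 4 * x ^ 2) - 4 * (t ^ 2 + x ^ 2) := by rw [ht]; ring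
        rw [this]; exact g1.sub (g3.mul_left 4)
      have g5 : z ∣ y ∧ z ∣ 17 * x := by
        rcases hz.dvd_or_dvd g4 with g | g
        · have g6 : z ∣ t := by
            apply hz.dvd_of_dvd_pow (n := 2)
            have := g3.sub (g.mul_left x)
            rwa [show t ^ 2 + x ^ 2 - x * x = t ^ 2 by ring] at this
          exact ⟨by rw [ht]; exact g.add (g6.mul_left 4), g.mul_left 17⟩
        · refine ⟨g, ?_⟩
          have : z ∣ (17 * x) * x := by
            have h7 : 17 * x * x = 16 * (t ^ 2 + x ^ 2) - (y - 2 * x) * y := by rw [ht]; ring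
            rw [h7]; exact (g3.mul_left 16).sub (g.mul_left _)
          rcases hz.dvd_or_dvd this with g | g
          · exact g
          · exact g.mul_left 17
      exact hz.not_isUnit (hc.isUnit_of_dvd' g5.1 g5.2)
  obtain ⟨g, -, hg⟩ := sq_left (by nlinarith [sq_nonneg (2 * t + x)]) hcop key
  -- f odd
  have hf : ∃ F, f = 2 * F + 1 := by
    rcases Int.even_or_odd' f with ⟨F, hF | hF⟩
    · rw [ha, hE, hF] at h2
      ring_nf at h2; omega
    · exact ⟨F, hF⟩
  obtain ⟨F, hF⟩ := hf
  have ht2 : ∃ T, t = 2 * T + 1 := by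
    rcases Int.even_or_odd' t with ⟨T, hT | hT⟩
    · exfalso
      have key2 : ((2 * t + x) ^ 2 + 4 * x ^ 2) * (t ^ 2 + x ^ 2) = 2 * f ^ 2 := by linarith
      rw [hF, hT, hX] at key2
      have k7 := congrArg (Int.cast : ℤ → ZMod 2) key2
      push_cast at k7
      generalize (T : ZMod 2) = m, (X : ZMod 2) = n, (F : ZMod 2) = k at *
      revert k7; clear * -; revert m n k; decide +kernel
    · exact ⟨T, hT⟩
  obtain ⟨T, hT⟩ := ht2
  rw [hT, hX] at hg
  have k7 := congrArg (Int.cast : ℤ → ZMod 8) hg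
  push_cast at k7
  generalize (T : ZMod 8) = m, (X : ZMod 8) = n, (g : ZMod 8) = k at *
  revert k7; clear * -; revert m n k; decide +kernel

theorem case_ii_aux {A C e f : ℤ} (hA : A % 2 = 1)
    (hcop : IsCoprime A e) (h1 : C ^ 2 = 16 * e ^ 2 + 17 * A ^ 2)
    (h2 : A ^ 2 + e ^ 2 = 2 * f ^ 2) (hp1 : 0 < C + 4 * e) (hp2 : 0 < C - 4 * e) (h17 : (17 : ℤ) ∣ C - 4 * e) : False := by
  obtain ⟨w, hw⟩ := h17
  have p17 : Prime (17 : ℤ) := by rw [Int.prime_iff_natAbs_prime]; norm_num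
  have hm : w * (C + 4 * e) = A ^ 2 := by
    have : (C - 4 * e) * (C + 4 * e) = 17 * A ^ 2 := by linarith
    rw [hw] at this; linarith
  have hcA : ∀ z : ℤ, Prime z → z ∣ e → z ∣ A → False := fun z hz h1 h2 =>
    hz.not_isUnit (hcop.isUnit_of_dvd' h2 h1)
  have hcop1 : IsCoprime (C + 4 * e) (17 * w) := by
    refine isCoprime_of_prime_dvd (by omega) fun z hz g1 g2 => ?_
    rw [← hw] at g2
    have hAz : z ∣ A := hz.dvd_of_dvd_pow (n := 2) (hm ▸ g1.mul_left w)
    have g3 : z ∣ 2 ^ 3 * e := by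
      rw [show 2 ^ 3 * e = (C + 4 * e) - (C - 4 * e) by ring]; exact g1.sub g2
    rcases hz.dvd_or_dvd g3 with g | g
    · have h5 : Associated z 2 := hz.associated_of_dvd Int.prime_two (hz.dvd_of_dvd_pow g)
      have := h5.dvd_iff_dvd_left.1 hAz
      omega
    · exact hcA z hz g hAz
  have hw0 : 0 < w := by omega
  obtain ⟨x, y, hx, hy, p1, p2⟩ := sq_both hw0 hp1 (hcop1.of_mul_right_right.symm) hm
  rw [p1] at hw hm hcop1
  rw [p2] at hm hcop1
  have hc2 : IsCoprime y (17 * x) := by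
    rw [show 17 * x ^ 2 = (17 * x) * x by ring] at hcop1
    exact (IsCoprime.pow_left_iff (by norm_num)).1 hcop1.of_mul_right_left
  have odd : x % 2 = 1 ∧ y % 2 = 1 := by
    have : A ^ 2 % 2 = 1 := by
      rw [sq, Int.mul_emod, hA]; rfl
    rw [← hm] at this
    constructor
    · rcases Int.emod_two_eq_zero_or_one x with g | g
      · rw [Int.mul_emod, sq, Int.mul_emod x, g] at this; simp at this
      · exact g
    · rcases Int.emod_two_eq_zero_or_one y with g | g
      · rw [Int.mul_emod, sq y, Int.mul_emod y, g] at this; simp at this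
      · exact g
  have hy8 : y ^ 2 - 17 * x ^ 2 = 8 * e := by linarith
  rcases (show (y - x) % 4 = 0 ∨ (-y - x) % 4 = 0 by omega) with g | g
  · exact case_ii_core (t := (y - x) / 4) hy8 h2 hm.symm hA hc2 (by omega)
  · refine case_ii_core (y := -y) (t := (-y - x) / 4) (by rw [neg_sq]; exact hy8) h2 (by rw [neg_sq]; exact hm.symm) hA hc2.neg_left (by omega)

theorem case_ii {A B C D : ℤ} (hA : A % 2 = 1) (hApos : 0 < A) (hC : 0 < C)
    (hcop : IsCoprime A B) (h1 : A ^ 2 + 2 * B ^ 2 = C ^ 2)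
    (h2 : 2 * B ^ 2 - 16 * A ^ 2 = D ^ 2) : False := by
  obtain ⟨e, rfl⟩ := two_dvd_of_sq (a := D) (B ^ 2 - 8 * A ^ 2) (by linarith)
  obtain ⟨b, rfl⟩ := two_dvd_of_sq (a := B) (e ^ 2 + 4 * A ^ 2) (by linarith)
  obtain ⟨e, rfl⟩ := two_dvd_of_sq (a := e) (b ^ 2 - 2 * A ^ 2) (by linarith)
  obtain ⟨f, rfl⟩ := two_dvd_of_sq (a := b) (e ^ 2 + A ^ 2) (by linarith)
  have h3 : A ^ 2 + e ^ 2 = 2 * f ^ 2 := by linarith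
  have h4 : C ^ 2 = 16 * e ^ 2 + 17 * A ^ 2 := by linarith
  have hcb : IsCoprime A f := (hcop.of_mul_right_right).of_mul_right_right
  have p17 : Prime (17 : ℤ) := by rw [Int.prime_iff_natAbs_prime]; norm_num
  have hce : IsCoprime A e := by
    refine isCoprime_of_prime_dvd (by omega) fun z hz g1 g2 => ?_
    have g3 : z ∣ 2 * f ^ 2 := by
      rw [← h3]; exact (g1.trans (dvd_pow_self _ two_ne_zero)).add (g2.trans (dvd_pow_self _ two_ne_zero))
    rcases hz.dvd_or_dvd g3 with g | g
    · have h5 : Associated z 2 := hz.associated_of_dvd Int.prime_two g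
      have := h5.dvd_iff_dvd_left.1 g1
      omega
    · exact hz.not_isUnit (hcb.isUnit_of_dvd' g1 (hz.dvd_of_dvd_pow g))
  have hab : |4 * e| < |C| := by
    apply sq_lt_sq.1
    nlinarith [sq_pos_of_pos hApos]
  rw [abs_of_pos hC, abs_lt] at hab
  have h17 : (17 : ℤ) ∣ (C - 4 * e) * (C + 4 * e) := ⟨A ^ 2, by linarith⟩
  rcases p17.dvd_or_dvd h17 with g | g
  · exact case_ii_aux hA hce h4 h3 (by omega) (by omega) g
  · exact case_ii_aux (C := C) (f := f) (e := -e) hA hce.neg_right (by rw [neg_sq]; exact h4) (by rw [neg_sq]; exact h3) (by omega) (by omega)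
      (by rw [show C - 4 * -e = C + 4 * e by ring]; exact g)

end

section
set_option autoImplicit false

theorem class17 (d : ℤ) (hd : d = 1 ∨ d = 2) (q r s : ℤ) (hq : 0 < q) (hr : 0 < r) (hqr : IsCoprime q r)
    (h17 : ¬ (17 : ℤ) ∣ r) (h : d * q * (r + 16 * q) * (r + 17 * q) * r = s ^ 2) :
    ∃ A B C D : ℤ, 0 < A ∧ 0 < B ∧ 0 < C ∧ 0 < D ∧ q = d * A ^ 2 ∧ r + 16 * q = B ^ 2 ∧
      r + 17 * q = C ^ 2 ∧ r = D ^ 2 := by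
  have p17 : Prime (17 : ℤ) := by rw [Int.prime_iff_natAbs_prime]; norm_num
  obtain ⟨p, hp⟩ : ∃ p, p = r + 16 * q := ⟨_, rfl⟩
  obtain ⟨t, ht⟩ : ∃ t, t = r + 17 * q := ⟨_, rfl⟩
  have hp0 : 0 < p := by omega
  have ht0 : 0 < t := by omega
  have cqp : IsCoprime q p := by rw [hp]; exact hqr.add_mul_right_right 16
  have cqt : IsCoprime q t := by rw [ht]; exact hqr.add_mul_right_right 17
  have cpt : IsCoprime p t := by
    rw [show t = q + 1 * p by omega]; exact cqp.symm.add_mul_right_right 1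
  have crt : IsCoprime r t := by
    refine isCoprime_of_prime_dvd (by omega) fun z hz g1 g2 => ?_
    have g3 : z ∣ 17 * q := by
      rw [show 17 * q = t - r by omega]; exact g2.sub g1
    rcases hz.dvd_or_dvd g3 with g | g
    · exact h17 ((hz.associated_of_dvd p17 g).dvd_iff_dvd_left.1 g1)
    · exact hz.not_isUnit (hqr.isUnit_of_dvd' g g1)
  have gpr : ∀ l : ℤ, l ∣ p → l ∣ r → l ∣ 2 ^ 4 := by
    intro l h1 h2
    have h3 : l ∣ 16 * q := by rw [show 16 * q = p - r by omega]; exact h1.sub h2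
    exact (hqr.symm.of_isCoprime_of_dvd_left h2).dvd_of_dvd_mul_right h3
  rw [← hp, ← ht] at h ⊢
  clear h17 p17
  rcases hd with rfl | rfl
  · -- d = 1
    obtain ⟨A, hA, rfl⟩ := sq_left hq ((cqp.mul_right cqt).mul_right hqr) (by linarith : q * (p * t * r) = s ^ 2)
    obtain ⟨C, hC, rfl⟩ := sq_left ht0 ((cqt.symm.mul_right cpt.symm).mul_right crt.symm)
      (by linarith : t * (A ^ 2 * p * r) = s ^ 2)
    have hAs : A * C ∣ s := by
      rw [← Int.pow_dvd_pow_iff two_ne_zero, ← h]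
      exact ⟨p * r, by ring⟩
    obtain ⟨s', rfl⟩ := hAs
    have hpr : p * r = s' ^ 2 := by
      apply mul_left_cancel₀ (show A ^ 2 * C ^ 2 ≠ 0 by positivity)
      linarith
    rcases sq_or_two_sq 4 hp0 hr gpr hpr with ⟨B, D, hB, hD, e1, e2⟩ | ⟨B, D, hB, hD, e1, e2⟩
    · exact ⟨A, B, C, D, hA, hB, hC, hD, by ring, e1, rfl, e2⟩
    · exfalso
      have hAo : A % 2 = 1 := by
        by_contra hc
        obtain ⟨a, rfl⟩ : ∃ a, A = 2 * a := ⟨A / 2, by omega⟩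
        have := cqp.isUnit_of_dvd' (x := 2) ⟨2 * a ^ 2, by ring⟩ ⟨B ^ 2, e1⟩
        revert this; decide
      exact case_one (A := A) (B := B) (C := C) (D := D) hAo (by linarith) (by linarith)
  · -- d = 2
    by_cases hq2 : (2 : ℤ) ∣ q
    · obtain ⟨q', rfl⟩ := hq2
      have n2 : ∀ n : ℤ, IsCoprime (2 * q') n → IsCoprime (2 * (2 * q')) n := fun n h =>
        h.of_mul_left_left.mul_left h
      obtain ⟨A, hA, e0⟩ := sq_left (by omega) (n2 _ ((cqp.mul_right cqt).mul_right hqr))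
        (by linarith : (2 * (2 * q')) * (p * t * r) = s ^ 2)
      obtain ⟨A, rfl⟩ := two_dvd_of_sq _ e0.symm
      obtain ⟨C, hC, rfl⟩ := sq_left ht0 (((n2 _ cqt).symm.mul_right cpt.symm).mul_right crt.symm)
        (by linarith : t * (2 * (2 * q') * p * r) = s ^ 2)
      have cpr : IsCoprime p r := by
        have := cqp.symm
        rw [show p = r + 16 * (2 * q') by omega]
        refine isCoprime_of_prime_dvd (by omega) fun z hz g1 g2 => ?_
        have g3 : z ∣ 16 * (2 * q') := by
          have := g1.sub g2
          rwa [add_sub_cancel_left] at this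
        have g4 : z ∣ 2 * q' := by
          rcases hz.dvd_or_dvd g3 with g | g
          · have h8 : z ∣ (2 : ℤ) ^ 4 := by norm_num; exact g
            exact (hz.dvd_of_dvd_pow h8).mul_right _
          · exact g
        exact hz.not_isUnit (hqr.isUnit_of_dvd' g4 g2)
      obtain ⟨B, hB, rfl⟩ := sq_left hp0 (((n2 _ cqp).symm.mul_right cpt).mul_right cpr)
        (by linarith : p * (2 * (2 * q') * C ^ 2 * r) = s ^ 2)
      obtain ⟨D, hD, rfl⟩ := sq_left hr (((n2 _ hqr).symm.mul_right cpr.symm).mul_right crt)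
        (by linarith : r * (2 * (2 * q') * B ^ 2 * C ^ 2) = s ^ 2)
      exact ⟨A, B, C, D, by omega, hB, hC, hD, by linarith, rfl, rfl, rfl⟩
    · have cq2 : IsCoprime q 2 := by
        refine isCoprime_of_prime_dvd (by omega) fun z hz g1 g2 => ?_
        exact hq2 ((hz.associated_of_dvd Int.prime_two g2).dvd_iff_dvd_left.1 g1)
      obtain ⟨A, hA, rfl⟩ := sq_left hq (((cq2.mul_right cqp).mul_right cqt).mul_right hqr)
        (by linarith : q * (2 * p * t * r) = s ^ 2)
      have hAo : A % 2 = 1 := by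
        by_contra hc
        obtain ⟨a, rfl⟩ : ∃ a, A = 2 * a := ⟨A / 2, by omega⟩
        exact hq2 ⟨2 * a ^ 2, by ring⟩
      obtain ⟨a, ha⟩ : ∃ a, A = 2 * a + 1 := ⟨A / 2, by omega⟩
      have hq1 : A ^ 2 = 2 * (2 * a ^ 2 + 2 * a) + 1 := by rw [ha]; ring
      by_cases hp2 : (2 : ℤ) ∣ p
      · have ct2 : IsCoprime t 2 := by
          refine isCoprime_of_prime_dvd (by omega) fun z hz g1 g2 => ?_
          have := (hz.associated_of_dvd Int.prime_two g2).dvd_iff_dvd_left.1 g1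
          omega
        obtain ⟨C, hC, rfl⟩ := sq_left ht0 (((ct2.mul_right cqt.symm).mul_right cpt.symm).mul_right crt.symm)
          (by linarith : t * (2 * A ^ 2 * p * r) = s ^ 2)
        have hAs : A * C ∣ s := by
          rw [← Int.pow_dvd_pow_iff two_ne_zero, ← h]
          exact ⟨2 * p * r, by ring⟩
        obtain ⟨s', rfl⟩ := hAs
        have hpr : 2 * p * r = s' ^ 2 := by
          apply mul_left_cancel₀ (show A ^ 2 * C ^ 2 ≠ 0 by positivity)
          linarith
        have cA : IsCoprime A p := (IsCoprime.pow_left_iff (by norm_num)).1 cqp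
        rcases two_sq_cases 4 hp0 hr gpr hpr with ⟨B, D, hB, hD, rfl, rfl⟩ | ⟨B, D, hB, hD, rfl, rfl⟩
        · exact (case_ii (A := A) (B := B) (C := C) (D := D) hAo hA hC
            ((IsCoprime.pow_right_iff (by norm_num)).1 cA.of_mul_right_right) (by linarith) (by linarith)).elim
        · have hBe : B % 2 = 0 := by
            have := Int.prime_two.dvd_of_dvd_pow hp2
            omega
          exact (case_i (A := A) (B := B) (C := C) (D := D) hAo hA hB hC hD hBe
            ((IsCoprime.pow_right_iff (by norm_num)).1 cA) (by linarith) (by linarith)).elim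
      · have cp2 : IsCoprime p 2 := by
          refine isCoprime_of_prime_dvd (by omega) fun z hz g1 g2 => ?_
          exact hp2 ((hz.associated_of_dvd Int.prime_two g2).dvd_iff_dvd_left.1 g1)
        have cr2 : IsCoprime r 2 := by
          refine isCoprime_of_prime_dvd (by omega) fun z hz g1 g2 => ?_
          have := (hz.associated_of_dvd Int.prime_two g2).dvd_iff_dvd_left.1 g1
          omega
        have cpr : IsCoprime p r := by
          refine isCoprime_of_prime_dvd (by omega) fun z hz g1 g2 => ?_
          exact hz.not_isUnit (cp2.isUnit_of_dvd' g1 (hz.dvd_of_dvd_pow (gpr z g1 g2)))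
        obtain ⟨B, hB, rfl⟩ := sq_left hp0 (((cp2.mul_right cqp.symm).mul_right cpt).mul_right cpr)
          (by linarith : p * (2 * A ^ 2 * t * r) = s ^ 2)
        obtain ⟨D, hD, rfl⟩ := sq_left hr (((cr2.mul_right hqr.symm).mul_right cpr.symm).mul_right crt)
          (by linarith : r * (2 * A ^ 2 * B ^ 2 * t) = s ^ 2)
        have hAs : A * B * D ∣ s := by
          rw [← Int.pow_dvd_pow_iff two_ne_zero, ← h]
          exact ⟨2 * t, by ring⟩
        obtain ⟨s', rfl⟩ := hAs
        have hpr : 2 * t = s' ^ 2 := by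
          apply mul_left_cancel₀ (show A ^ 2 * B ^ 2 * D ^ 2 ≠ 0 by positivity)
          linarith
        obtain ⟨C, rfl⟩ := two_dvd_of_sq _ hpr.symm
        have hBo : B % 2 = 1 := by
          by_contra hc
          obtain ⟨b, rfl⟩ : ∃ a, B = 2 * a := ⟨B / 2, by omega⟩
          exact hp2 ⟨2 * b ^ 2, by ring⟩
        have hC0 : C ≠ 0 := by rintro rfl; simp at hpr; omega
        exact (case_iv (A := A) (B := B) (C := |C|) (D := D) hAo hBo hA hB (by positivity) hD
          ((IsCoprime.pow_iff (by norm_num) (by norm_num)).1 cqp) (by rw [sq_abs]; linarith) (by linarith)).elim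

end

section
set_option autoImplicit false

/-- The cubic attached to the curve 2-isogenous to the quotient of the level 17 curve. -/
def H17 (z : ℚ) : ℚ := z * (z - 16) * (z + 1)

theorem halve17_alg (d z a b c : ℚ) (hd : 0 < d) (ha : 0 < a) (hb : 0 < b) (hc : 0 < c)
    (h1 : d * z = a ^ 2) (h2 : d * (z - 16) = b ^ 2) (h3 : d * (z + 1) = c ^ 2) :
    ∃ m y : ℚ, z < m ∧ d * y ^ 2 = H17 m ∧ z * (4 * H17 m) = m ^ 4 + 32 * m ^ 2 + 256 := by
  have hz : z = a ^ 2 / d := by field_simp; linarith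
  have e2 : a ^ 2 - b ^ 2 = 16 * d := by linarith
  have e3 : c ^ 2 - a ^ 2 = d := by linarith
  have m1 : (a + b) * (a + c) / d - 16 = (b + a) * (b + c) / d := by
    field_simp; linear_combination e2
  have m2 : (a + b) * (a + c) / d + 1 = (c + a) * (c + b) / d := by
    field_simp; linear_combination -e3
  have hy : d * ((a + b) * (a + c) * (b + c) / d ^ 2) ^ 2 = H17 ((a + b) * (a + c) / d) := by
    rw [H17, m1, m2]; field_simp
    ring
  refine ⟨(a + b) * (a + c) / d, (a + b) * (a + c) * (b + c) / d ^ 2, ?_, hy, ?_⟩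
  · rw [hz]
    gcongr
    nlinarith [mul_pos ha hb, mul_pos ha hc, mul_pos hb hc]
  · have m3 : ((a + b) * (a + c) / d) ^ 2 + 16 = 2 * a * (a + b) * (a + c) * (b + c) / d ^ 2 := by
      field_simp
      linear_combination (-d) * e2 - (a ^ 2 - b ^ 2) * e3
    rw [← hy, hz, show ((a + b) * (a + c) / d) ^ 4 + 32 * ((a + b) * (a + c) / d) ^ 2 + 256 =
      (((a + b) * (a + c) / d) ^ 2 + 16) ^ 2 by ring, m3]
    field_simp
    ring

theorem height17 (x m : ℚ) (hm : 0 < m) (h : x * (4 * H17 m) = m ^ 4 + 32 * m ^ 2 + 256) (hx : 0 < x) :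
    m.num ^ 4 ≤ 295936 * x.num ∧ 0 < m.num := by
  have hq : 0 < m.den := m.den_pos
  have hqx : 0 < x.den := x.den_pos
  have hcm := m.reduced
  have hcx := x.reduced
  have hP : 0 < m.num := Rat.num_pos.2 (by linarith)
  have hpx : 0 < x.num := Rat.num_pos.2 hx
  have em : m = m.num / m.den := (Rat.num_div_den m).symm
  have ex : x = x.num / x.den := (Rat.num_div_den x).symm
  refine ⟨?_, hP⟩
  have hq' : (m.den : ℚ) ≠ 0 := by positivity
  have hqx' : (x.den : ℚ) ≠ 0 := by positivity
  generalize x.num = p at *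
  generalize x.den = q at *
  generalize m.num = P at *
  generalize m.den = Q at *
  have key : p * (4 * Q * P * (P - 16 * Q) * (P + Q)) = q * (P ^ 4 + 32 * P ^ 2 * Q ^ 2 + 256 * Q ^ 4) := by
    have : (p : ℚ) * (4 * Q * P * (P - 16 * Q) * (P + Q)) = q * (P ^ 4 + 32 * P ^ 2 * Q ^ 2 + 256 * Q ^ 4) := by
      rw [em, ex] at h
      simp only [H17] at h
      field_simp at h
      linear_combination h
    exact_mod_cast this
  have hcop : IsCoprime p (q : ℤ) := Int.isCoprime_iff_nat_coprime.2 (by simpa using hcx)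
  have hcop2 : IsCoprime P (Q : ℤ) := Int.isCoprime_iff_nat_coprime.2 (by simpa using hcm)
  obtain ⟨e, he⟩ : p ∣ P ^ 4 + 32 * P ^ 2 * Q ^ 2 + 256 * Q ^ 4 := hcop.dvd_of_dvd_mul_left ⟨_, key.symm⟩
  have he2 : (4 * Q * P * (P - 16 * Q) * (P + Q)) = q * e := by
    rw [he] at key
    apply mul_left_cancel₀ hpx.ne'
    linear_combination key
  have d1 : e ∣ 295936 * P ^ 7 :=
    ⟨1024 * (p * (289 * P ^ 3 - 480 * P ^ 2 * Q - 768 * P * Q ^ 2) +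
        q * (120 * P ^ 3 - 320 * P ^ 2 * Q + 960 * P * Q ^ 2 - 3072 * Q ^ 3)), by
      linear_combination 1024 * (289 * P ^ 3 - 480 * P ^ 2 * Q - 768 * P * Q ^ 2) * he +
        1024 * (120 * P ^ 3 - 320 * P ^ 2 * Q + 960 * P * Q ^ 2 - 3072 * Q ^ 3) * he2⟩
  have d2 : e ∣ 295936 * Q ^ 7 :=
    ⟨p * (1156 * Q ^ 3 + 120 * P * Q ^ 2 - 12 * P ^ 2 * Q) +
        q * (480 * Q ^ 3 + 80 * P * Q ^ 2 + 15 * P ^ 2 * Q + 3 * P ^ 3), by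
      linear_combination (1156 * Q ^ 3 + 120 * P * Q ^ 2 - 12 * P ^ 2 * Q) * he +
        (480 * Q ^ 3 + 80 * P * Q ^ 2 + 15 * P ^ 2 * Q + 3 * P ^ 3) * he2⟩
  obtain ⟨a, b, hab⟩ := (hcop2.pow : IsCoprime (P ^ 7) ((Q : ℤ) ^ 7))
  have d3 : e ∣ 295936 := by
    have := (d1.mul_left a).add (d2.mul_left b)
    rwa [show a * (295936 * P ^ 7) + b * (295936 * Q ^ 7) = (295936 : ℤ) by linear_combination 295936 * hab] at this
  have hle := Int.le_of_dvd (by norm_num) d3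
  have hQ : (0 : ℤ) < Q := by exact_mod_cast hq
  have : P ^ 4 ≤ p * e := by
    rw [← he]
    have h1 : 0 ≤ P ^ 2 * (Q : ℤ) ^ 2 := by positivity
    have h3 : 0 ≤ (Q : ℤ) ^ 4 := by positivity
    linarith
  nlinarith

theorem int_sq_of_rat (n : ℤ) (w : ℚ) (h : (n : ℚ) = w ^ 2) : ∃ s : ℤ, n = s ^ 2 := by
  have : IsSquare (n : ℚ) := ⟨w, by rw [h, sq]⟩
  rw [Rat.isSquare_intCast_iff] at this
  obtain ⟨s, hs⟩ := this
  exact ⟨s, by rw [hs, sq]⟩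

/-- numerators and denominators -/
theorem frac17 (z : ℚ) (hz : 16 < z) : ∃ q r : ℤ, 0 < q ∧ 0 < r ∧ IsCoprime q r ∧ z.num = r + 16 * q ∧
    z.den = q ∧ z = (r + 16 * q) / q := by
  have ez : z = z.num / z.den := (Rat.num_div_den z).symm
  have hq : (0 : ℤ) < z.den := by exact_mod_cast z.den_pos
  have hq' : (0 : ℚ) < z.den := by exact_mod_cast z.den_pos
  have hcop : IsCoprime z.num (z.den : ℤ) := Int.isCoprime_iff_nat_coprime.2 (by simpa using z.reduced)
  refine ⟨z.den, z.num - 16 * z.den, hq, ?_, ?_, by ring, rfl, ?_⟩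
  · have : 16 * (z.den : ℚ) < z.num := by
      rw [ez, lt_div_iff₀ hq'] at hz
      exact hz
    have : 16 * (z.den : ℤ) < z.num := by exact_mod_cast this
    omega
  · have := hcop.symm.add_mul_right_right (-16)
    rwa [show z.num + -16 * (z.den : ℤ) = z.num - 16 * z.den by ring] at this
  · push_cast
    rw [sub_add_cancel]; exact ez

theorem step17 (d : ℤ) (hd : d = 1 ∨ d = 2) (z w : ℚ) (hz : 16 < z) (h : d * w ^ 2 = H17 z)
    (h17 : ¬ (17 : ℤ) ∣ z.num + z.den) :
    ∃ m y : ℚ, 16 < m ∧ d * y ^ 2 = H17 m ∧ m.num ^ 4 ≤ 295936 * z.num ∧ 0 < m.num := by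
  obtain ⟨q, r, hq, hr, hqr, e1, e2, e3⟩ := frac17 z hz
  have hq' : (0 : ℚ) < q := by exact_mod_cast hq
  have hd0 : (0 : ℚ) < d := by rcases hd with rfl | rfl <;> norm_num
  rw [e1, e2] at h17
  obtain ⟨s, hs⟩ := int_sq_of_rat (d * q * (r + 16 * q) * (r + 17 * q) * r) (d * w * q ^ 2) (by
    rw [H17, e3] at h
    field_simp at h
    push_cast
    linear_combination (-d * (q : ℚ)) * h)
  obtain ⟨A, B, C, D, hA, hB, hC, hD, f1, f2, f3, f4⟩ := class17 d hd q r s hq hr hqr (by omega) hs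
  have f1' : (q : ℚ) = d * A ^ 2 := by exact_mod_cast f1
  have f2' : (r : ℚ) + 16 * q = B ^ 2 := by exact_mod_cast f2
  have f3' : (r : ℚ) + 17 * q = C ^ 2 := by exact_mod_cast f3
  have f4' : (r : ℚ) = D ^ 2 := by exact_mod_cast f4
  have hA' : (0 : ℚ) < A := by exact_mod_cast hA
  have hB' : (0 : ℚ) < B := by exact_mod_cast hB
  have hC' : (0 : ℚ) < C := by exact_mod_cast hC
  have hD' : (0 : ℚ) < D := by exact_mod_cast hD
  have ez : z = B ^ 2 / (d * A ^ 2) := by rw [e3, f2', f1']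
  have ez2 : z - 16 = D ^ 2 / (d * A ^ 2) := by
    rw [← f1', ← f4', e3]; field_simp; ring
  have ez3 : z + 1 = C ^ 2 / (d * A ^ 2) := by
    rw [← f1', ← f3', e3]; field_simp; ring
  obtain ⟨m, y, g1, g2, g3⟩ := halve17_alg d z (B / A) (D / A) (C / A) hd0 (by positivity) (by positivity) (by positivity)
    (by rw [ez]; field_simp) (by rw [ez2]; field_simp) (by rw [ez3]; field_simp)
  obtain ⟨g4, g5⟩ := height17 z m (by linarith) g3 (by linarith)
  exact ⟨m, y, hz.trans g1, g2, g4, g5⟩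

theorem trans17 (d : ℤ) (z w : ℚ) (hz : 16 < z) (h : d * w ^ 2 = H17 z)
    (h17 : (17 : ℤ) ∣ z.num + z.den) :
    ∃ m y : ℚ, 16 < m ∧ d * y ^ 2 = H17 m ∧ m.num ≤ z.num ∧ ¬ (17 : ℤ) ∣ m.num + m.den := by
  obtain ⟨q, r, hq, hr, hqr, e1, e2, e3⟩ := frac17 z hz
  have hz0 : z - 16 ≠ 0 := by linarith
  have hzp : 0 < z - 16 := by linarith
  have hm : 16 < 16 * (z + 1) / (z - 16) := by
    rw [lt_div_iff₀ hzp]; linarith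
  refine ⟨16 * (z + 1) / (z - 16), 272 * w / (z - 16) ^ 2, hm, ?_, ?_⟩
  · rw [H17] at h ⊢
    field_simp
    linear_combination (272 ^ 2) * h
  · rw [e1, e2] at h17
    have h17r : (17 : ℤ) ∣ r := by omega
    obtain ⟨v, rfl⟩ := h17r
    have hq' : (0 : ℚ) < q := by exact_mod_cast hq
    have hv : (0 : ℚ) < v := by exact_mod_cast (by omega : 0 < v)
    obtain ⟨Q, R, hQ, hR, hQR, E1, E2, E3⟩ := frac17 _ hm
    rw [E1, E2, e1]
    have hQ' : (0 : ℚ) < Q := by exact_mod_cast hQ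
    have key : (R + 16 * Q) * v = 16 * (v + q) * Q := by
      have : ((R : ℚ) + 16 * Q) * v = 16 * (v + q) * Q := by
        have h1 : 16 * (z + 1) / (z - 16) = 16 * (v + q) / v := by
          rw [div_eq_div_iff hz0 hv.ne', e3]; push_cast; field_simp; ring
        rw [h1, div_eq_div_iff hv.ne' hQ'.ne'] at E3
        linarith
      exact_mod_cast this
    have hv0 : 0 < v := by omega
    constructor
    · have c1 : IsCoprime (R + 16 * Q) Q := (hQR.add_mul_right_right 16).symm
      have : R + 16 * Q ∣ 16 * (v + q) := c1.dvd_of_dvd_mul_right ⟨v, key.symm⟩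
      have := Int.le_of_dvd (by omega) this
      omega
    · intro hc
      have hRQ : (R + 17 * Q) * v = (17 * v + 16 * q) * Q := by linarith
      have p17 : Prime (17 : ℤ) := by rw [Int.prime_iff_natAbs_prime]; norm_num
      have h1 : (17 : ℤ) ∣ (17 * v + 16 * q) * Q := by rw [← hRQ]; exact Dvd.dvd.mul_right (by omega) v
      rcases p17.dvd_or_dvd h1 with g | g
      · have g2 : (17 : ℤ) ∣ q := by omega
        exact p17.not_isUnit (hqr.isUnit_of_dvd' g2 ⟨v, rfl⟩)
      · exact p17.not_isUnit (hQR.isUnit_of_dvd' g (by omega))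

theorem check17 : ∀ d ∈ [1, 2], ∀ p ∈ List.range 67, ∀ q ∈ List.range 5, 0 < q → 16 * q < p →
    Int.sqrt ((d : ℤ) * q * p * (p - 16 * q) * (p + q)) * Int.sqrt ((d : ℤ) * q * p * (p - 16 * q) * (p + q)) ≠
      (d : ℤ) * q * p * (p - 16 * q) * (p + q) := by
  decide +kernel

theorem no17_big (d : ℤ) (hd : d = 1 ∨ d = 2) (z w : ℚ) (hz : 16 < z) (h : d * w ^ 2 = H17 z) : False := by
  obtain ⟨n, hn⟩ : ∃ n : ℕ, z.num < n := ⟨z.num.natAbs + 1, by omega⟩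
  induction n generalizing z w with
  | zero =>
    have := Rat.num_pos.2 ((show (0 : ℚ) < 16 by norm_num).trans hz)
    rw [Nat.cast_zero] at hn; omega
  | succ n ih =>
    by_cases hsmall : z.num < 67
    · obtain ⟨q, r, hq, hr, hqr, e1, e2, e3⟩ := frac17 z hz
      have hq' : (0 : ℚ) < q := by exact_mod_cast hq
      obtain ⟨s, hs⟩ := int_sq_of_rat (d * q * (r + 16 * q) * r * (r + 17 * q)) (d * w * q ^ 2) (by
        rw [H17, e3] at h
        field_simp at h
        push_cast
        linear_combination (-d * (q : ℚ)) * h)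
      obtain ⟨p', hp⟩ : ∃ p : ℕ, (p : ℤ) = r + 16 * q := ⟨(r + 16 * q).toNat, by omega⟩
      obtain ⟨q', hq2⟩ : ∃ p : ℕ, (p : ℤ) = q := ⟨q.toNat, by omega⟩
      refine check17 d (by simpa using hd) p' (by rw [List.mem_range]; omega) q' (by rw [List.mem_range]; omega) (by omega) (by omega) ?_
      have : d * (q' : ℤ) * p' * (p' - 16 * q') * (p' + q') = s * s := by
        rw [hp, hq2, ← sq, ← hs]; ring
      rw [this, Int.sqrt_eq, ← Int.natCast_mul, Int.natAbs_mul_self]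
    · obtain ⟨z', w', a1, a2, a3, a4⟩ : ∃ m y : ℚ, 16 < m ∧ d * y ^ 2 = H17 m ∧ m.num ≤ z.num ∧
          ¬ (17 : ℤ) ∣ m.num + m.den := by
        by_cases h17 : (17 : ℤ) ∣ z.num + z.den
        · exact trans17 d z w hz h h17
        · exact ⟨z, w, hz, h, le_rfl, h17⟩
      obtain ⟨m, y, b1, b2, b3, b4⟩ := step17 d hd z' w' a1 a2 a4
      refine ih m y b1 b2 ?_
      have hlt : m.num < z.num := by
        by_contra hc
        push Not at hc hsmall
        have h5 : z.num ^ 4 ≤ m.num ^ 4 := by gcongr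
        have h6 : 67 ^ 3 ≤ z.num ^ 3 := by gcongr
        nlinarith
      push_cast at hn; omega

theorem lemma17 (d : ℤ) (hd : d = 1 ∨ d = 2) (z w : ℚ) (h : d * w ^ 2 = H17 z) : w = 0 := by
  by_contra hw
  have hd0 : (0 : ℚ) < d := by rcases hd with rfl | rfl <;> norm_num
  have hpos : 0 < H17 z := by rw [← h]; positivity
  by_cases hz : 16 < z
  · exact no17_big d hd z w hz h
  push Not at hz
  rw [H17] at hpos
  have hz0 : z < 0 := by
    by_contra hc
    push Not at hc
    have : z * (z - 16) * (z + 1) ≤ 0 := by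
      have h1 : 0 ≤ z * (z + 1) := by positivity
      nlinarith
    linarith
  have hz1 : -1 < z := by
    by_contra hc
    push Not at hc
    have : z * (z - 16) * (z + 1) ≤ 0 := by
      have h1 : 0 ≤ z * (z - 16) := by nlinarith
      nlinarith
    linarith
  refine no17_big d hd (-16 / z) (16 * w / z ^ 2) ?_ ?_
  · rw [lt_div_iff_of_neg hz0]; linarith
  · rw [H17] at h ⊢
    have := hz0.ne
    field_simp
    linear_combination h

end


/-- `K` is the quadratic extension of `ℚ` generated by `θ` with `θ ^ 2 = d`. -/
structure QuadData (K : Type*) [Field K] [CharZero K] (θ : K) (d : ℤ) : Prop where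
  sq_eq : θ ^ 2 = (d : K)
  gen : ∀ x : K, ∃ a b : ℚ, x = a + b * θ
  ind : ∀ a b : ℚ, (a : K) + b * θ = 0 → a = 0 ∧ b = 0

theorem quadData_adjoin (z : ℝ) (d : ℤ) (hz : z ^ 2 = d) (hd : ¬ IsSquare d) :
    QuadData ℚ⟮z⟯ (AdjoinSimple.gen ℚ z) d := by
  have hns : ∀ q : ℚ, q ^ 2 ≠ d := by
    intro q hq
    apply hd
    rw [← Rat.isSquare_intCast_iff]
    exact ⟨q, by rw [← hq, sq]⟩
  have hind : ∀ a b : ℚ, (a : ℝ) + b * z = 0 → a = 0 ∧ b = 0 := by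
    intro a b h
    have hb : b = 0 := by
      by_contra hb
      have hb' : (b : ℝ) ≠ 0 := by exact_mod_cast hb
      have h1 : z = ((-a / b : ℚ) : ℝ) := by
        push_cast
        field_simp
        linarith
      apply hns (-a / b)
      rw [h1] at hz
      exact_mod_cast hz
    subst hb
    simpa using h
  refine ⟨?_, ?_, ?_⟩
  · apply Subtype.ext
    simpa using hz
  · rintro ⟨x, hx⟩
    suffices ∃ a b : ℚ, x = a + b * z by
      obtain ⟨a, b, h⟩ := this
      exact ⟨a, b, Subtype.ext (by simpa using h)⟩
    induction hx using IntermediateField.adjoin_induction with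
    | mem x hx => exact ⟨0, 1, by rw [Set.mem_singleton_iff.1 hx]; simp⟩
    | algebraMap x => exact ⟨x, 0, by simp⟩
    | add x y _ _ h1 h2 =>
      obtain ⟨a, b, rfl⟩ := h1
      obtain ⟨a', b', rfl⟩ := h2
      exact ⟨a + a', b + b', by push_cast; ring⟩
    | mul x y _ _ h1 h2 =>
      obtain ⟨a, b, rfl⟩ := h1
      obtain ⟨a', b', rfl⟩ := h2
      exact ⟨a * a' + d * b * b', a * b' + a' * b, by push_cast; rw [← hz]; ring⟩
    | inv x _ h1 =>
      obtain ⟨a, b, rfl⟩ := h1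
      by_cases h0 : (a : ℝ) + b * z = 0
      · exact ⟨0, 0, by rw [h0]; simp⟩
      · have h1 : (a : ℝ) - b * z ≠ 0 := by
          intro h
          have := hind a (-b) (by push_cast; linarith)
          apply h0
          rw [this.1, neg_eq_zero.1 this.2]; simp
        have h2 : (a : ℝ) ^ 2 - d * b ^ 2 ≠ 0 := by
          have := mul_ne_zero h0 h1
          rw [← hz]; intro h; apply this; linear_combination h
        refine ⟨a / (a ^ 2 - d * b ^ 2), -b / (a ^ 2 - d * b ^ 2), ?_⟩
        push_cast
        rw [inv_eq_iff_eq_inv, ← mul_div_right_comm, ← add_div, inv_div]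
        rw [eq_div_iff (by rw [neg_mul, ← sub_eq_add_neg]; exact h1), ← hz]
        ring
  · intro a b h
    apply hind
    have := congrArg (Subtype.val) h
    simpa using this

theorem twist_point (b2 b4 b6 d x0 x1 w0 w1 k x3 : ℚ) (hx1 : x1 ≠ 0)
    (hk : w0 = k * (x1 * d)) (hx3 : x3 = (d * k ^ 2 - b2) / 4 - 2 * x0)
    (e1 : w0 ^ 2 + d * w1 ^ 2 = 4 * (x0 ^ 3 + 3 * x0 * x1 ^ 2 * d) + b2 * (x0 ^ 2 + d * x1 ^ 2) + b4 * x0 + b6)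
    (e2 : 2 * w0 * w1 = 4 * (3 * x0 ^ 2 * x1 + d * x1 ^ 3) + 2 * b2 * x0 * x1 + b4 * x1) :
    d * (w1 + k * (x3 - x0)) ^ 2 = 4 * x3 ^ 3 + b2 * x3 ^ 2 + b4 * x3 + b6 := by
  have hb : 2 * k * d * w1 = 4 * (3 * x0 ^ 2 + d * x1 ^ 2) + 2 * b2 * x0 + b4 := by
    apply mul_left_cancel₀ hx1
    rw [hk] at e2
    linear_combination e2
  rw [hk] at e1
  rw [hx3]
  linear_combination e1 + ((d * k ^ 2 - b2) / 4 - 3 * x0) * hb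

section QuadCurve

variable {K : Type*} [Field K] [CharZero K] {θ : K} {d : ℤ}

theorem QuadData.components (D : QuadData K θ d) (b2 b4 b6 x0 x1 w0 w1 : ℚ)
    (h : ((w0 : K) + w1 * θ) ^ 2 = 4 * (x0 + x1 * θ) ^ 3 + b2 * (x0 + x1 * θ) ^ 2 + b4 * (x0 + x1 * θ) + b6) :
    w0 ^ 2 + d * w1 ^ 2 = 4 * (x0 ^ 3 + 3 * x0 * x1 ^ 2 * d) + b2 * (x0 ^ 2 + d * x1 ^ 2) + b4 * x0 + b6 ∧
    2 * w0 * w1 = 4 * (3 * x0 ^ 2 * x1 + d * x1 ^ 3) + 2 * b2 * x0 * x1 + b4 * x1 := by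
  have := D.ind
    (w0 ^ 2 + d * w1 ^ 2 - (4 * (x0 ^ 3 + 3 * x0 * x1 ^ 2 * d) + b2 * (x0 ^ 2 + d * x1 ^ 2) + b4 * x0 + b6))
    (2 * w0 * w1 - (4 * (3 * x0 ^ 2 * x1 + d * x1 ^ 3) + 2 * b2 * x0 * x1 + b4 * x1)) (by
      push_cast
      linear_combination h + (-(w1 : K) ^ 2 + 12 * x0 * x1 ^ 2 + b2 * x1 ^ 2 + 4 * x1 ^ 3 * θ) * D.sq_eq)
  exact ⟨sub_eq_zero.1 this.1, sub_eq_zero.1 this.2⟩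

/-- If the twist has no points, then every point over the quadratic field is rational. -/
theorem QuadData.no_twist (D : QuadData K θ d) (b2 b4 b6 : ℚ) (hd0 : d ≠ 0)
    (htw : ∀ x v : ℚ, d * v ^ 2 ≠ 4 * x ^ 3 + b2 * x ^ 2 + b4 * x + b6)
    (x w : K) (h : w ^ 2 = 4 * x ^ 3 + b2 * x ^ 2 + b4 * x + b6) :
    ∃ x0 w0 : ℚ, x = x0 ∧ w0 ^ 2 = 4 * x0 ^ 3 + b2 * x0 ^ 2 + b4 * x0 + b6 := by
  obtain ⟨x0, x1, rfl⟩ := D.gen x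
  obtain ⟨w0, w1, rfl⟩ := D.gen w
  obtain ⟨e1, e2⟩ := D.components _ _ _ _ _ _ _ h
  have hd0' : (d : ℚ) ≠ 0 := by exact_mod_cast hd0
  by_cases hx1 : x1 = 0
  · subst hx1
    have h0 : w0 * w1 = 0 := by linarith
    rcases mul_eq_zero.1 h0 with rfl | rfl
    · exact (htw x0 w1 (by linarith)).elim
    · exact ⟨x0, w0, by simp, by linarith⟩
  · exact (htw _ _ (twist_point b2 b4 b6 d x0 x1 w0 w1 (w0 / (x1 * d)) _ hx1 (by field_simp) rfl e1 e2)).elim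

theorem rat17 (d : ℤ) (hd : d = 1 ∨ d = 2) (x w : ℚ) (h : d * w ^ 2 = 4 * x ^ 3 + (-3) * x ^ 2 + (-2) * x + (-55)) :
    (x = 11 / 4 ∧ w = 0) ∨ (x = 7 ∧ d = 1) := by
  have hd0 : (0 : ℚ) < d := by rcases hd with rfl | rfl <;> norm_num
  obtain ⟨z, hz⟩ : ∃ z : ℚ, x = (z + 11) / 4 := ⟨4 * x - 11, by ring⟩
  subst hz
  have h1 : d * (4 * w) ^ 2 = z * (z ^ 2 + 30 * z + 289) := by linear_combination 16 * h
  by_cases hz : z = 0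
  · left
    subst hz
    refine ⟨by norm_num, ?_⟩
    have : (d : ℚ) * (4 * w) ^ 2 = 0 := by rw [h1]; ring
    simpa [hd0.ne'] using this
  · right
    have h2 := lemma17 d hd ((z ^ 2 + 30 * z + 289) / (4 * z)) (4 * w * (z ^ 2 - 289) / (8 * z ^ 2)) (by
      have e1 : (z ^ 2 + 30 * z + 289) / (4 * z) - 16 = (z - 17) ^ 2 / (4 * z) := by field_simp; ring
      have e2 : (z ^ 2 + 30 * z + 289) / (4 * z) + 1 = (z + 17) ^ 2 / (4 * z) := by field_simp; ring
      have e3 : d * (4 * w * (z ^ 2 - 289) / (8 * z ^ 2)) ^ 2 = (d * (4 * w) ^ 2) * ((z ^ 2 - 289) / (8 * z ^ 2)) ^ 2 := by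
        ring
      rw [e3, H17, e1, e2, h1]
      field_simp
      ring)
    have h3 : 4 * w * (z ^ 2 - 289) = 0 := by
      rcases div_eq_zero_iff.1 h2 with h | h
      · exact h
      · exact absurd h (by positivity)
    rcases mul_eq_zero.1 h3 with h4 | h4
    · exfalso
      rw [h4] at h1
      have : z ^ 2 + 30 * z + 289 ≠ 0 := by nlinarith [sq_nonneg (z + 15)]
      have h5 : z * (z ^ 2 + 30 * z + 289) = 0 := by rw [← h1]; ring
      exact mul_ne_zero hz this h5
    · have h5 : (z - 17) * (z + 17) = 0 := by linarith
      rcases mul_eq_zero.1 h5 with h6 | h6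
      · have h7 : z = 17 := by linarith
        subst h7
        refine ⟨by norm_num, ?_⟩
        rcases hd with rfl | rfl
        · rfl
        · exfalso
          refine not_mul_sq 2 18496 (nonsq _ (by decide +kernel)) (4 * w) ?_
          rw [h1]; norm_num
      · exfalso
        have h7 : z = -17 := by linarith
        subst h7
        have : 0 ≤ d * (4 * w) ^ 2 := by positivity
        rw [h1] at this
        norm_num at this

theorem QuadData.quad17 (D : QuadData K θ 2) (x w : K)
    (h : w ^ 2 = 4 * x ^ 3 + ((-3 : ℚ) : K) * x ^ 2 + ((-2 : ℚ) : K) * x + ((-55 : ℚ) : K)) :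
    x = ((11 / 4 : ℚ) : K) ∨ x = ((7 : ℚ) : K) := by
  obtain ⟨x0, x1, rfl⟩ := D.gen x
  obtain ⟨w0, w1, rfl⟩ := D.gen w
  obtain ⟨e1, e2⟩ := D.components _ _ _ _ _ _ _ h
  by_cases hx1 : x1 = 0
  · subst hx1
    have h0 : w0 * w1 = 0 := by linarith
    rcases mul_eq_zero.1 h0 with rfl | rfl
    · rcases rat17 2 (by simp) x0 w1 (by linarith) with h1 | h1
      · left; simp [h1.1]
      · left; exact absurd h1.2 (by norm_num)
    · rcases rat17 1 (by simp) x0 w0 (by push_cast; linarith) with h1 | h1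
      · left; simp [h1.1]
      · right; simp [h1.1]
  · exfalso
    obtain ⟨k, hk⟩ : ∃ k, w0 = k * (x1 * ((2 : ℤ) : ℚ)) := ⟨w0 / (x1 * 2), by push_cast; field_simp⟩
    have h1 := twist_point _ _ _ _ x0 x1 w0 w1 k _ hx1 hk rfl e1 e2
    rcases rat17 2 (by simp) _ _ h1 with ⟨h2, h3⟩ | h2
    · rw [h2] at h3
      push_cast at h2 hk e2
      have hk2 : 2 * k ^ 2 = 8 * x0 + 8 := by linarith
      have hw1 : w1 = k * (x0 - 11 / 4) := by linarith
      have e3 : 4 * k ^ 2 * (x0 - 11 / 4) = 12 * x0 ^ 2 + 8 * x1 ^ 2 - 6 * x0 - 2 := by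
        apply mul_left_cancel₀ hx1
        rw [hk, hw1] at e2
        linear_combination e2
      have e4 : 8 * x1 ^ 2 = 4 * x0 ^ 2 - 22 * x0 - 42 := by
        linear_combination -e3 + 2 * (x0 - 11 / 4) * hk2
      have e5 : ((1 : ℤ) : ℚ) * (k * 2 * x1) ^ 2 = H17 (2 * (x0 + 1)) := by
        rw [H17]; push_cast
        linear_combination 2 * x1 ^ 2 * hk2 + 2 * (x0 + 1) * e4
      have e6 := lemma17 1 (by simp) _ _ e5
      have hk0 : k = 0 := by
        by_contra hk0
        exact mul_ne_zero (mul_ne_zero hk0 two_ne_zero) hx1 e6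
      subst hk0
      have hx0 : x0 = -1 := by linarith
      subst hx0
      nlinarith [sq_nonneg x1]
    · exact absurd h2.2 (by norm_num)

theorem card_points (W : WeierstrassCurve.Affine K) (L : Set (K × K))
    (h : ∀ x y, W.Nonsingular x y ↔ (x, y) ∈ L) (hL : L.Finite) : Nat.card W.Point = L.ncard + 1 := by
  have e : W.Point ≃ Option L :=
    (WeierstrassCurve.Affine.nonsingularPointEquiv W).trans
      (Equiv.optionCongr (Equiv.subtypeEquivRight fun xy => h xy.1 xy.2))
  have : Finite L := hL
  rw [Nat.card_congr e, Finite.card_option, Nat.card_coe_set_eq]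

theorem X0_11_points (D : QuadData K θ d) (hd : d = 3 ∨ d = 5) :
    Nat.card (X0_11 K).Point = 5 ∧ PointsRational (X0_11 K) := by
  have key : ∀ x y, (X0_11 K).Nonsingular x y ↔ (x, y) ∈ ({(5, 5), (5, -6), (16, 60), (16, -61)} : Set (K × K)) := by
    intro x y
    simp only [WeierstrassCurve.Affine.nonsingular_iff', WeierstrassCurve.Affine.equation_iff, X0_11,
      Set.mem_insert_iff, Set.mem_singleton_iff, Prod.mk.injEq]
    constructor
    · rintro ⟨h, -⟩
      obtain ⟨x0, w0, rfl, h2⟩ := D.no_twist (-4) (-40) (-79) (by omega)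
        (fun x v hv => final11 d hd x v (by rw [hv, G11]; ring)) x (2 * y + 1) (by push_cast; linear_combination 4 * h)
      rcases final11_1 x0 w0 (by rw [h2, G11]; ring) with rfl | rfl
      · have h3 : (y - 5) * (y + 6) = 0 := by push_cast at h; linear_combination h
        rcases mul_eq_zero.1 h3 with h4 | h4
        · left; exact ⟨by norm_num, by linear_combination h4⟩
        · right; left; exact ⟨by norm_num, by linear_combination h4⟩
      · have h3 : (y - 60) * (y + 61) = 0 := by push_cast at h; linear_combination h
        rcases mul_eq_zero.1 h3 with h4 | h4
        · right; right; left; exact ⟨by norm_num, by linear_combination h4⟩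
        · right; right; right; exact ⟨by norm_num, by linear_combination h4⟩
    · rintro (⟨rfl, rfl⟩ | ⟨rfl, rfl⟩ | ⟨rfl, rfl⟩ | ⟨rfl, rfl⟩) <;> norm_num
  constructor
  · rw [card_points _ _ key (Set.toFinite _)]
    rw [Set.ncard_insert_of_notMem, Set.ncard_insert_of_notMem, Set.ncard_pair]
    all_goals
      simp only [Set.mem_insert_iff, Set.mem_singleton_iff, Prod.mk.injEq, ne_eq]
      norm_num
  · intro x y h
    have := (key x y).1 h
    simp only [Set.mem_insert_iff, Set.mem_singleton_iff, Prod.mk.injEq] at this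
    rcases this with ⟨rfl, rfl⟩ | ⟨rfl, rfl⟩ | ⟨rfl, rfl⟩ | ⟨rfl, rfl⟩
    · exact ⟨⟨5, by norm_num⟩, ⟨5, by norm_num⟩⟩
    · exact ⟨⟨5, by norm_num⟩, ⟨-6, by norm_num⟩⟩
    · exact ⟨⟨16, by norm_num⟩, ⟨60, by norm_num⟩⟩
    · exact ⟨⟨16, by norm_num⟩, ⟨-61, by norm_num⟩⟩

theorem X0_19_points (D : QuadData K θ d) (hd : d = 5 ∨ d = 7) :
    Nat.card (X0_19 K).Point = 3 ∧ PointsRational (X0_19 K) := by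
  have key : ∀ x y, (X0_19 K).Nonsingular x y ↔ (x, y) ∈ ({(5, 9), (5, -10)} : Set (K × K)) := by
    intro x y
    simp only [WeierstrassCurve.Affine.nonsingular_iff', WeierstrassCurve.Affine.equation_iff, X0_19,
      Set.mem_insert_iff, Set.mem_singleton_iff, Prod.mk.injEq]
    constructor
    · rintro ⟨h, -⟩
      obtain ⟨x0, w0, rfl, h2⟩ := D.no_twist 4 (-36) (-59) (by omega)
        (fun x v hv => final19 d hd x v (by rw [hv, G19]; ring)) x (2 * y + 1) (by push_cast; linear_combination 4 * h)
      obtain rfl := final19_1 x0 w0 (by rw [h2, G19]; ring)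
      have h3 : (y - 9) * (y + 10) = 0 := by push_cast at h; linear_combination h
      rcases mul_eq_zero.1 h3 with h4 | h4
      · left; exact ⟨by norm_num, by linear_combination h4⟩
      · right; exact ⟨by norm_num, by linear_combination h4⟩
    · rintro (⟨rfl, rfl⟩ | ⟨rfl, rfl⟩) <;> norm_num
  constructor
  · rw [card_points _ _ key (Set.toFinite _), Set.ncard_pair]
    simp only [Prod.mk.injEq, ne_eq]
    norm_num
  · intro x y h
    have := (key x y).1 h
    simp only [Set.mem_insert_iff, Set.mem_singleton_iff, Prod.mk.injEq] at this
    rcases this with ⟨rfl, rfl⟩ | ⟨rfl, rfl⟩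
    · exact ⟨⟨5, by norm_num⟩, ⟨9, by norm_num⟩⟩
    · exact ⟨⟨5, by norm_num⟩, ⟨-10, by norm_num⟩⟩

theorem X0_17_points (D : QuadData K θ 2) :
    Nat.card (X0_17 K).Point = 4 ∧ PointsRational (X0_17 K) := by
  have key : ∀ x y, (X0_17 K).Nonsingular x y ↔
      (x, y) ∈ ({(11 / 4, -15 / 8), (7, 13), (7, -21)} : Set (K × K)) := by
    intro x y
    simp only [WeierstrassCurve.Affine.nonsingular_iff', WeierstrassCurve.Affine.equation_iff, X0_17,
      Set.mem_insert_iff, Set.mem_singleton_iff, Prod.mk.injEq]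
    constructor
    · rintro ⟨h, -⟩
      rcases D.quad17 x (2 * y + x + 1) (by push_cast; linear_combination 4 * h) with rfl | rfl
      · left
        have h3 : (y + 15 / 8) ^ 2 = 0 := by push_cast at h; linear_combination h
        have h4 := pow_eq_zero_iff (two_ne_zero) |>.1 h3
        exact ⟨by norm_num, by linear_combination h4⟩
      · right
        have h3 : (y - 13) * (y + 21) = 0 := by push_cast at h; linear_combination h
        rcases mul_eq_zero.1 h3 with h4 | h4
        · left; exact ⟨by norm_num, by linear_combination h4⟩
        · right; exact ⟨by norm_num, by linear_combination h4⟩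
    · rintro (⟨rfl, rfl⟩ | ⟨rfl, rfl⟩ | ⟨rfl, rfl⟩) <;> norm_num
  constructor
  · rw [card_points _ _ key (Set.toFinite _)]
    rw [Set.ncard_insert_of_notMem, Set.ncard_pair]
    all_goals
      simp only [Set.mem_insert_iff, Set.mem_singleton_iff, Prod.mk.injEq, ne_eq]
      norm_num
  · intro x y h
    have := (key x y).1 h
    simp only [Set.mem_insert_iff, Set.mem_singleton_iff, Prod.mk.injEq] at this
    rcases this with ⟨rfl, rfl⟩ | ⟨rfl, rfl⟩ | ⟨rfl, rfl⟩
    · exact ⟨⟨11 / 4, by norm_num⟩, ⟨-15 / 8, by norm_num⟩⟩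
    · exact ⟨⟨7, by norm_num⟩, ⟨13, by norm_num⟩⟩
    · exact ⟨⟨7, by norm_num⟩, ⟨-21, by norm_num⟩⟩

end QuadCurve


/-- For each pair `(d, p) ∈ {(2, 17), (3, 11), (5, 11), (5, 19), (7, 19)}`, the group
`X₀(p)(ℚ(√d))` coincides with the group `X₀(p)(ℚ)` of rational points; explicitly,
`X₀(17)(ℚ(√2))` has exactly 4 elements, `X₀(11)(ℚ(√3))` and `X₀(11)(ℚ(√5))` each have
exactly 5 elements, and `X₀(19)(ℚ(√5))` and `X₀(19)(ℚ(√7))` each have exactly 3 elements. -/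
theorem X0_points_rational_for_pairs :
    (∀ z : ℝ, z ^ 2 = 2 →
      Nat.card (X0_17 ℚ⟮z⟯).Point = 4 ∧ PointsRational (X0_17 ℚ⟮z⟯)) ∧
    (∀ z : ℝ, z ^ 2 = 3 →
      Nat.card (X0_11 ℚ⟮z⟯).Point = 5 ∧ PointsRational (X0_11 ℚ⟮z⟯)) ∧
    (∀ z : ℝ, z ^ 2 = 5 →
      (Nat.card (X0_11 ℚ⟮z⟯).Point = 5 ∧ PointsRational (X0_11 ℚ⟮z⟯)) ∧
      (Nat.card (X0_19 ℚ⟮z⟯).Point = 3 ∧ PointsRational (X0_19 ℚ⟮z⟯))) ∧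
    (∀ z : ℝ, z ^ 2 = 7 →
      Nat.card (X0_19 ℚ⟮z⟯).Point = 3 ∧ PointsRational (X0_19 ℚ⟮z⟯)) := by
  refine ⟨fun z hz => ?_, fun z hz => ?_, fun z hz => ?_, fun z hz => ?_⟩
  · exact X0_17_points (quadData_adjoin z 2 (by exact_mod_cast hz) (nonsq _ (by decide +kernel)))
  · exact X0_11_points (quadData_adjoin z 3 (by exact_mod_cast hz) (nonsq _ (by decide +kernel))) (by simp)
  · have D := quadData_adjoin z 5 (by exact_mod_cast hz) (nonsq _ (by decide +kernel))
    exact ⟨X0_11_points D (by simp), X0_19_points D (by simp)⟩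
  · exact X0_19_points (quadData_adjoin z 7 (by exact_mod_cast hz) (nonsq _ (by decide +kernel))) (by simp)
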